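/- For every natural number K ≥ 1 there exist N₂(K), N₄(K) ∈ ℕ such that for every ring R and every finite K-approximate subring X ⊆ R there exists a finite (K^510 + K^22)-approximate subring Y ⊆ 4X + X·4X which is N₂(K)-commensurable with X, and a two-sided ideal I of the subring ⟨Y⟩ generated by Y with I ⊆ Y, such that ⟨Y⟩/I is nilpotent of class at most N₄(K). -/

import Mathlib

open Pointwise

universe u

/-- A subset of a ring is additively symmetric if it contains `0` and equals its negation. -/
def AddSymm {R : Type u} [NonUnitalRing R] (X : Set R) : Prop :=
  (0 : R) ∈ X ∧ X = -X

/-- `X` is a `K`-approximate subring: it is additively symmetric and `X·X ∪ (X+X)` is covered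
by at most `K` additive translates of `X`. -/
def IsApproxSubringWith {R : Type u} [NonUnitalRing R] (K : ℕ) (X : Set R) : Prop :=
  AddSymm X ∧ ∃ F : Finset R, F.card ≤ K ∧ (X * X) ∪ (X + X) ⊆ (F : Set R) + X

/-- `A` and `B` are `N`-commensurable: each is covered by at most `N` additive translates
of the other. -/
def NCommensurable {R : Type u} [NonUnitalRing R] (N : ℕ) (A B : Set R) : Prop :=
  (∃ F : Finset R, F.card ≤ N ∧ A ⊆ (F : Set R) + B) ∧
  (∃ G : Finset R, G.card ≤ N ∧ B ⊆ (G : Set R) + A)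

/-- `mulIter S n` is the set of (left-nested) products of `n+1` elements of `S`. -/
def mulIter {R : Type u} [NonUnitalRing R] (S : Set R) : ℕ → Set R
  | 0 => S
  | n + 1 => mulIter S n * S

/-- `I` is a two-sided ideal of the subring `S` (both given as sets). -/
def IsTwoSidedIdealIn {R : Type u} [NonUnitalRing R] (I S : Set R) : Prop :=
  I ⊆ S ∧ (0 : R) ∈ I ∧ (∀ x ∈ I, ∀ y ∈ I, x + y ∈ I) ∧ (∀ x ∈ I, -x ∈ I) ∧
    ∀ r ∈ S, ∀ x ∈ I, r * x ∈ I ∧ x * r ∈ I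


noncomputable section Dual

open MeasureTheory

/-- Multiplicative copy of `A` with the discrete topology. -/
def MulDisc (A : Type u) : Type u := Multiplicative A

instance (A : Type u) [AddCommGroup A] : CommGroup (MulDisc A) :=
  inferInstanceAs (CommGroup (Multiplicative A))

instance (A : Type u) : TopologicalSpace (MulDisc A) := ⊥

instance (A : Type u) : DiscreteTopology (MulDisc A) := ⟨rfl⟩

/-- The compact dual of the discrete group `A`. -/
abbrev Dl (A : Type u) [AddCommGroup A] : Type u := PontryaginDual (MulDisc A)

/-- Evaluation of a character, as a complex number. -/
def ev {A : Type u} [AddCommGroup A] (χ : Dl A) (x : A) : ℂ :=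
  ((χ (Multiplicative.ofAdd x : Multiplicative A) : Circle) : ℂ)

section basics
variable {A : Type u} [AddCommGroup A]

lemma ev_add (χ : Dl A) (x y : A) : ev χ (x + y) = ev χ x * ev χ y := by
  have := map_mul χ (Multiplicative.ofAdd x : MulDisc A) (Multiplicative.ofAdd y : MulDisc A)
  unfold ev
  rw [← Circle.coe_mul]
  exact congrArg _ this

lemma norm_ev (χ : Dl A) (x : A) : ‖ev χ x‖ = 1 := Circle.norm_coe _

lemma ev_ne (χ : Dl A) (x : A) : ev χ x ≠ 0 := by
  intro h; have := norm_ev χ x; rw [h] at this; simp at this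

lemma ev_zero (χ : Dl A) : ev χ 0 = 1 := by
  have := ev_add χ 0 0
  rw [add_zero] at this
  have h := ev_ne χ 0
  exact (mul_left_cancel₀ h (by rw [← this, mul_one])) 

lemma ev_neg (χ : Dl A) (x : A) : ev χ (-x) = star (ev χ x) := by
  have h := ev_add χ x (-x)
  rw [add_neg_cancel, ev_zero] at h
  have h2 : ev χ x * star (ev χ x) = 1 := by
    have := Complex.mul_conj (ev χ x)
    rw [Complex.normSq_eq_norm_sq, norm_ev] at this
    simpa using this
  exact mul_left_cancel₀ (ev_ne χ x) (by rw [← h, h2])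

lemma ev_sub (χ : Dl A) (x y : A) : ev χ (x - y) = ev χ x * star (ev χ y) := by
  rw [sub_eq_add_neg, ev_add, ev_neg]

lemma ev_mul (χ ψ : Dl A) (x : A) : ev (χ * ψ) x = ev χ x * ev ψ x := rfl

lemma ev_inv (χ : Dl A) (x : A) : ev (χ⁻¹) x = star (ev χ x) := by
  have h : ev (χ * χ⁻¹) x = 1 := by rw [mul_inv_cancel]; rfl
  rw [ev_mul] at h
  have h2 : ev χ x * star (ev χ x) = 1 := by
    have := Complex.mul_conj (ev χ x)
    rw [Complex.normSq_eq_norm_sq, norm_ev] at this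
    simpa using this
  exact mul_left_cancel₀ (ev_ne χ x) (by rw [h, h2])

lemma continuous_ev (x : A) : Continuous (fun χ : Dl A => ev χ x) := by
  unfold ev
  have : Continuous (fun χ : Dl A => χ (Multiplicative.ofAdd x : MulDisc A)) := by
    have h := (ContinuousMonoidHom.isInducing_toContinuousMap (MulDisc A) Circle).continuous
    exact (continuous_eval_const (F := C(MulDisc A, Circle)) (Multiplicative.ofAdd x : MulDisc A)).comp h
  exact continuous_subtype_val.comp this

/-- character from a function -/
def mkDl (f : A → ℂ) (h1 : ∀ x, ‖f x‖ = 1) (h2 : ∀ x y, f (x + y) = f x * f y) : Dl A :=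
  (⟨MonoidHom.mk' (fun x : MulDisc A => (⟨f (Multiplicative.toAdd (x : Multiplicative A)), by
      simp [Submonoid.unitSphere, h1]⟩ : Circle))
    (fun x y => Subtype.ext (h2 _ _)), continuous_of_discreteTopology⟩ : MulDisc A →ₜ* Circle)

lemma ev_mkDl (f : A → ℂ) (h1 : ∀ x, ‖f x‖ = 1) (h2 : ∀ x y, f (x + y) = f x * f y) (x : A) :
    ev (mkDl f h1 h2) x = f x := rfl

lemma exists_ev_ne_one {x : A} (hx : x ≠ 0) : ∃ χ : Dl A, ev χ x ≠ 1 := by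
  obtain ⟨c, hc⟩ := CharacterModule.exists_character_apply_ne_zero_of_ne_zero hx
  have key : ∃ g : AddCircle (1 : ℚ) →+ Additive Circle, Function.Injective g := by
    let g0 : ℚ →+ Additive Circle :=
      { toFun := fun q => Additive.ofMul (Circle.exp (2 * Real.pi * (q : ℝ)))
        map_zero' := by simp
        map_add' := by
          intro a b
          rw [← ofMul_mul, ← Circle.exp_add]
          congr 2
          push_cast; ring }
    have hk : ∀ q : ℚ, g0 q = 0 ↔ q ∈ AddSubgroup.zmultiples (1 : ℚ) := by
      intro q
      change Circle.exp (2 * Real.pi * (q : ℝ)) = 1 ↔ _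
      rw [Circle.exp_eq_one, AddSubgroup.mem_zmultiples_iff]
      constructor
      · rintro ⟨n, hn⟩
        refine ⟨n, ?_⟩
        have h2 : (2 * Real.pi) ≠ 0 := by positivity
        have : (q : ℝ) = n := by
          apply mul_left_cancel₀ h2; rw [hn]; ring
        simp
        exact_mod_cast this.symm
      · rintro ⟨n, hn⟩
        refine ⟨n, ?_⟩
        rw [← hn]; push_cast; simp; ring
    refine ⟨QuotientAddGroup.lift _ g0 (fun q hq => (hk q).2 hq), ?_⟩
    rw [injective_iff_map_eq_zero]
    intro a
    induction a using QuotientAddGroup.induction_on with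
    | H z =>
      intro h
      exact (QuotientAddGroup.eq_zero_iff z).2 ((hk z).1 h)
  obtain ⟨g, hg⟩ := key
  refine ⟨mkDl (fun y => ((Additive.toMul (g (c y)) : Circle) : ℂ)) (fun y => Circle.norm_coe _) ?_, ?_⟩
  · intro a b
    simp
  · rw [ev_mkDl]
    intro h
    apply hc
    apply hg
    rw [map_zero]
    have : (Additive.toMul (g (c x)) : Circle) = 1 := by
      apply Subtype.ext; exact h
    exact this

instance : MeasurableSpace (Dl A) := borel _
instance : BorelSpace (Dl A) := ⟨rfl⟩

/-- Haar probability measure on the dual. -/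
def hm (A : Type u) [AddCommGroup A] : Measure (Dl A) := Measure.haarMeasure ⊤

instance : IsProbabilityMeasure (hm A) := ⟨by
  have := Measure.haarMeasure_self (K₀ := (⊤ : TopologicalSpace.PositiveCompacts (Dl A)))
  simpa [hm] using this⟩

instance : (hm A).IsMulLeftInvariant := by unfold hm; infer_instance

lemma integrable_of_cont {E : Type} [NormedAddCommGroup E] {f : Dl A → E} 
    (hf : Continuous f) : Integrable f (hm A) :=
  hf.integrable_of_hasCompactSupport (HasCompactSupport.of_compactSpace f)

lemma integral_ev (x : A) [Decidable (x = 0)] : ∫ χ, ev χ x ∂(hm A) = if x = 0 then 1 else 0 := by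
  split_ifs with h
  · subst h; simp [ev_zero]
  · obtain ⟨ψ, hψ⟩ := exists_ev_ne_one h
    have h1 : ∫ χ, ev (ψ * χ) x ∂(hm A) = ∫ χ, ev χ x ∂(hm A) :=
      integral_mul_left_eq_self (fun χ => ev χ x) ψ
    simp_rw [ev_mul] at h1
    rw [integral_const_mul] at h1
    have : (ev ψ x - 1) * ∫ χ, ev χ x ∂(hm A) = 0 := by rw [sub_mul, h1]; ring
    rcases mul_eq_zero.1 this with h2 | h2
    · exact absurd (sub_eq_zero.1 h2) hψ
    · exact h2

/-- trigonometric sum -/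
def tr {ι : Type*} (I : Finset ι) (φ : ι → A) (χ : Dl A) : ℂ := ∑ i ∈ I, ev χ (φ i)

lemma continuous_tr {ι : Type*} (I : Finset ι) (φ : ι → A) : Continuous (tr I φ) := by
  unfold tr
  exact continuous_finsetSum _ (fun i _ => continuous_ev _)

lemma norm_tr_le {ι : Type*} (I : Finset ι) (φ : ι → A) (χ : Dl A) : ‖tr I φ χ‖ ≤ I.card := by
  unfold tr
  refine (norm_sum_le _ _).trans ?_
  simp [norm_ev]

open Classical in
lemma fourier_tr {ι : Type*} (I : Finset ι) (φ : ι → A) (y : A) :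
    ∫ χ, ‖tr I φ χ‖ ^ 2 * (ev χ y).re ∂(hm A)
      = (((I ×ˢ I).filter (fun p => φ p.1 - φ p.2 + y = 0)).card : ℝ) := by
  have h1 : ∀ χ : Dl A, ((‖tr I φ χ‖ ^ 2 : ℝ) : ℂ) * ev χ y
      = ∑ p ∈ I ×ˢ I, ev χ (φ p.1 - φ p.2 + y) := by
    intro χ
    have : ((‖tr I φ χ‖ ^ 2 : ℝ) : ℂ) = tr I φ χ * star (tr I φ χ) := by
      have := Complex.mul_conj (tr I φ χ)
      rw [Complex.normSq_eq_norm_sq] at this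
      exact this.symm
    rw [this, tr, star_sum, Finset.sum_mul_sum, Finset.sum_mul, Finset.sum_product]
    refine Finset.sum_congr rfl fun i _ => ?_
    rw [Finset.sum_mul]
    refine Finset.sum_congr rfl fun j _ => ?_
    rw [ev_add, ev_sub]
  have h2 : ∫ χ, ((‖tr I φ χ‖ ^ 2 : ℝ) : ℂ) * ev χ y ∂(hm A)
      = (((I ×ˢ I).filter (fun p => φ p.1 - φ p.2 + y = 0)).card : ℂ) := by
    simp_rw [h1]
    rw [integral_finset_sum _ (fun p _ => integrable_of_cont (continuous_ev _))]
    simp_rw [integral_ev]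
    simp
  have h3 : ∫ χ, (((‖tr I φ χ‖ ^ 2 : ℝ) : ℂ) * ev χ y).re ∂(hm A)
      = (∫ χ, ((‖tr I φ χ‖ ^ 2 : ℝ) : ℂ) * ev χ y ∂(hm A)).re := by
    refine integral_re (𝕜 := ℂ) (f := fun χ => ((‖tr I φ χ‖ ^ 2 : ℝ) : ℂ) * ev χ y) 
      (integrable_of_cont ?_)
    have := continuous_tr I φ
    have := continuous_ev y
    fun_prop
  rw [h2] at h3
  simp_rw [Complex.re_ofReal_mul] at h3
  rw [h3]; simp

open Classical in
lemma energy_ge {ι : Type*} (I : Finset ι) (φ : ι → A) (S : Finset A) (hS : ∀ i ∈ I, φ i ∈ S) :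
    (I.card : ℝ) ^ 2 ≤ S.card * ∫ χ, ‖tr I φ χ‖ ^ 2 ∂(hm A) := by
  have h := fourier_tr I φ 0
  simp_rw [ev_zero] at h
  simp only [Complex.one_re, mul_one, add_zero] at h
  rw [h]
  have h1 : I.card = ∑ s ∈ S, (I.filter (fun i => φ i = s)).card :=
    Finset.card_eq_sum_card_fiberwise hS
  have h2 : ∑ s ∈ S, (I.filter (fun i => φ i = s)).card ^ 2
      ≤ ((I ×ˢ I).filter (fun p => φ p.1 - φ p.2 = 0)).card := by
    rw [Finset.card_eq_sum_card_fiberwise (f := fun p => φ p.1) (t := S)]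
    · refine Finset.sum_le_sum fun s _ => ?_
      rw [sq, ← Finset.card_product]
      refine Finset.card_le_card ?_
      intro p hp
      simp only [Finset.mem_product, Finset.mem_filter] at hp ⊢
      refine ⟨⟨⟨hp.1.1, hp.2.1⟩, ?_⟩, hp.1.2⟩
      rw [hp.1.2, hp.2.2, sub_self]
    · intro p hp
      simp only [Finset.coe_filter, Finset.mem_product, Set.mem_ofPred_eq] at hp
      exact hS _ hp.1.1
  have h3 := sq_sum_le_card_mul_sum_sq (s := S) (f := fun s => (I.filter (fun i => φ i = s)).card)
  rw [← h1] at h3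
  have h4 : I.card ^ 2 ≤ S.card * ((I ×ˢ I).filter (fun p => φ p.1 - φ p.2 = 0)).card :=
    h3.trans (Nat.mul_le_mul_left _ h2)
  exact_mod_cast h4

end basics

end Dual

noncomputable section Spec
open MeasureTheory

/-- iterated sumset -/
def fS {A : Type u} [AddCommGroup A] [DecidableEq A] (X : Finset A) : ℕ → Finset A
  | 0 => {0}
  | k + 1 => fS X k + X

section
variable {A : Type u} [AddCommGroup A] [DecidableEq A]

lemma fS_add (X : Finset A) (a b : ℕ) : fS X (a + b) = fS X a + fS X b := by
  induction b with
  | zero => 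
    ext x; simp [fS, Finset.mem_add]
  | succ b ih => rw [← add_assoc, fS, ih, fS, add_assoc]

lemma fS_one (X : Finset A) : fS X 1 = X := by
  ext x; simp [fS, Finset.mem_add]

lemma fS_mono {X : Finset A} (h0 : (0 : A) ∈ X) {a b : ℕ} (h : a ≤ b) : fS X a ⊆ fS X b := by
  induction h with
  | refl => exact subset_rfl
  | step _ ih =>
    intro x hx
    have := Finset.add_mem_add (ih hx) h0
    rw [add_zero] at this
    exact this

lemma fS_card_free (F : Finset A) (k : ℕ) : (fS F k).card ≤ (k + 1) ^ F.card := by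
  classical
  have key : fS F k ⊆ (Fintype.piFinset (fun _ : F => Finset.range (k + 1))).image
      (fun n => ∑ f : F, n f • (f : A)) := by
    induction k with
    | zero =>
      intro x hx
      simp only [fS, Finset.mem_singleton] at hx
      rw [Finset.mem_image]
      exact ⟨fun _ => 0, by simp, by simp [hx]⟩
    | succ k ih =>
      intro x hx
      rw [fS, Finset.mem_add] at hx
      obtain ⟨y, hy, f, hf, rfl⟩ := hx
      obtain ⟨n, hn, rfl⟩ := Finset.mem_image.1 (ih hy)
      rw [Finset.mem_image]
      refine ⟨fun g => n g + if g = ⟨f, hf⟩ then 1 else 0, ?_, ?_⟩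
      · rw [Fintype.mem_piFinset] at hn ⊢
        intro g
        have := hn g
        simp only [Finset.mem_range] at this ⊢
        split_ifs <;> omega
      · simp [add_smul, Finset.sum_add_distrib]
  refine (Finset.card_le_card key).trans (Finset.card_image_le.trans ?_)
  simp

lemma fS_card {X F : Finset A} (hF : X + X ⊆ F + X) {K : ℕ} (hK : F.card ≤ K) (k : ℕ) :
    (fS X (k + 1)).card ≤ (k + 1) ^ K * X.card := by
  have h : fS X (k + 1) ⊆ fS F k + X := by
    induction k with
    | zero => simp [fS]
    | succ k ih =>
      rw [fS, fS]
      calc fS X (k + 1) + X ⊆ fS F k + X + X := Finset.add_subset_add_right ih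
        _ = fS F k + (X + X) := add_assoc _ _ _
        _ ⊆ fS F k + (F + X) := Finset.add_subset_add_left hF
        _ = _ := (add_assoc _ _ _).symm
  calc _ ≤ (fS F k + X).card := Finset.card_le_card h
    _ ≤ (fS F k).card * X.card := Finset.card_add_le
    _ ≤ _ := Nat.mul_le_mul_right _ ((fS_card_free F k).trans (Nat.pow_le_pow_right (by omega) hK))

end

/-- numeric pigeonhole for polynomial growth -/
lemma growth_pigeon (K : ℕ) (η : ℝ) (hη : 0 < η) : ∃ B : ℕ, ∀ (g : ℕ → ℕ) (x : ℕ), 1 ≤ x → 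
    Monotone g → g 1 = x → (∀ k, g (k + 1) ≤ (k + 1) ^ K * x) →
    ∃ k, 1 ≤ k ∧ g k ≤ B * x ∧ (g (k + 1) : ℝ) ≤ (1 + η) * g k ∧ g (2 * k) ≤ 2 ^ (2 * K + 1) * g k := by
  obtain ⟨j0, hj0⟩ : ∃ j0 : ℕ, (2 : ℝ) ^ (2 * K + 1) / η < 2 ^ j0 :=
    pow_unbounded_of_one_lt _ (by norm_num)
  rw [div_lt_iff₀ hη] at hj0
  refine ⟨(2 ^ (j0 + 2 * (K * j0 + 1) + 1)) ^ K, ?_⟩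
  intro g x hx hg h1 hgr
  have hgr' : ∀ k, 1 ≤ k → g k ≤ k ^ K * x := by
    intro k hk
    obtain ⟨m, rfl⟩ : ∃ m, k = m + 1 := ⟨k - 1, by omega⟩
    exact hgr m
  obtain ⟨i, hi, hL⟩ : ∃ i, i < K * j0 + 1 ∧ 
      g (2 ^ (j0 + 2 * i + 2)) ≤ 2 ^ (2 * K + 1) * g (2 ^ (j0 + 2 * i)) := by
    by_contra! hcon
    have hind : ∀ n, n ≤ K * j0 + 1 → (2 ^ (2 * K + 1)) ^ n * x ≤ g (2 ^ (j0 + 2 * n)) := by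
      intro n
      induction n with
      | zero =>
        intro _
        rw [pow_zero, one_mul, ← h1]
        exact hg Nat.one_le_two_pow
      | succ n ih =>
        intro hn
        have a := ih (by omega)
        have b := hcon n (by omega)
        calc _ = 2 ^ (2 * K + 1) * ((2 ^ (2 * K + 1)) ^ n * x) := by ring
          _ ≤ 2 ^ (2 * K + 1) * g (2 ^ (j0 + 2 * n)) := Nat.mul_le_mul_left _ a
          _ ≤ _ := b.le
    have a := hind _ le_rfl
    have b := hgr' (2 ^ (j0 + 2 * (K * j0 + 1))) Nat.one_le_two_pow
    have c := Nat.le_of_mul_le_mul_right (a.trans b) hx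
    rw [← pow_mul, ← pow_mul] at c
    have d := (Nat.pow_le_pow_iff_right (by norm_num)).1 c
    nlinarith
  set j := j0 + 2 * i with hj
  obtain ⟨k, hk1, hk2, hk3⟩ : ∃ k, 2 ^ j ≤ k ∧ k < 2 ^ (j + 1) ∧ (g (k + 1) : ℝ) ≤ (1 + η) * g k := by
    by_contra! hcon
    have hind : ∀ n, n ≤ 2 ^ j → (1 + n * η) * g (2 ^ j) ≤ (g (2 ^ j + n) : ℝ) := by
      intro n
      induction n with
      | zero => intro _; simp
      | succ n ih =>
        intro hn
        have a := ih (by omega)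
        have b := hcon (2 ^ j + n) (by omega) (by rw [pow_succ]; omega)
        have c : (g (2 ^ j) : ℝ) ≤ g (2 ^ j + n) := by exact_mod_cast hg (by omega)
        rw [← add_assoc]
        push_cast
        nlinarith
    have a := hind _ le_rfl
    have b : (g (2 ^ j + 2 ^ j) : ℝ) ≤ 2 ^ (2 * K + 1) * g (2 ^ j) := by
      have : g (2 ^ j + 2 ^ j) ≤ g (2 ^ (j + 2)) := hg (by rw [pow_add 2 j 2]; omega)
      exact_mod_cast this.trans hL
    have c : (1 : ℝ) ≤ g (2 ^ j) := by
      have : g 1 ≤ g (2 ^ j) := hg Nat.one_le_two_pow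
      exact_mod_cast (hx.trans (h1 ▸ this))
    have d : (2 : ℝ) ^ j0 ≤ 2 ^ j := pow_le_pow_right₀ (by norm_num) (by omega)
    push_cast at a
    have e : (1 + 2 ^ j * η) ≤ (2 : ℝ) ^ (2 * K + 1) := by
      by_contra! h
      nlinarith
    nlinarith
  refine ⟨k, le_trans Nat.one_le_two_pow hk1, ?_, hk3, ?_⟩
  · refine (hgr' k (le_trans Nat.one_le_two_pow hk1)).trans (Nat.mul_le_mul_right _ ?_)
    refine Nat.pow_le_pow_left ?_ K
    refine hk2.le.trans (Nat.pow_le_pow_right (by norm_num) (by omega))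
  · calc g (2 * k) ≤ g (2 ^ (j + 2)) := hg (by rw [pow_succ] at hk2 ⊢; omega)
      _ ≤ _ := hL
      _ ≤ _ := Nat.mul_le_mul_left _ (hg hk1)

section
variable {A : Type u} [AddCommGroup A] [DecidableEq A]

lemma integral_tr_sq (X : Finset A) : ∫ χ, ‖tr X id χ‖ ^ 2 ∂(hm A) = X.card := by
  have h := fourier_tr X id 0
  simp_rw [ev_zero] at h
  simp only [Complex.one_re, mul_one, add_zero] at h
  rw [h]
  norm_cast
  refine Finset.card_bij' (fun p _ => p.1) (fun x _ => (x, x)) ?_ ?_ ?_ ?_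
  · intro p hp; simp only [Finset.mem_filter, Finset.mem_product] at hp; exact hp.1.1
  · intro x hx; simp [hx]
  · intro p hp; simp only [Finset.mem_filter, id, sub_eq_zero] at hp; exact Prod.ext rfl hp.2
  · intro x hx; rfl

lemma large_close {X W : Finset A} (h0 : (0 : A) ∈ X) {η ρ : ℝ} (hρ : 0 < ρ)
    (hW : ((W + X).card : ℝ) ≤ (1 + η) * W.card) (hW0 : 0 < W.card) {l : Dl A} 
    (hl : ρ * W.card ≤ ‖tr W id l‖) {x : A} (hx : x ∈ X) : ‖ev l x - 1‖ ≤ 2 * η / ρ := by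
  set V : Finset A := W.image (fun w => w + x) with hV
  have hVc : V.card = W.card := Finset.card_image_of_injective _ (add_left_injective x)
  have h1 : ev l x * tr W id l = ∑ v ∈ V, ev l v := by
    rw [hV, Finset.sum_image (fun a _ b _ h => add_left_injective x h), tr, Finset.mul_sum]
    exact Finset.sum_congr rfl fun w _ => by rw [ev_add, mul_comm]; rfl
  have h2 : (ev l x - 1) * tr W id l = ∑ v ∈ V \ W, ev l v - ∑ v ∈ W \ V, ev l v := by
    rw [sub_mul, h1, one_mul, tr]
    simp only [id]
    rw [← Finset.sum_sdiff_sub_sum_sdiff]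
  have hWsub : W ⊆ W + X := fun w hw => by
    simpa using Finset.add_mem_add hw h0
  have hVsub : V ⊆ W + X := by
    intro v hv
    obtain ⟨w, hw, rfl⟩ := Finset.mem_image.1 hv
    exact Finset.add_mem_add hw hx
  have c1 : ((V \ W).card : ℝ) ≤ η * W.card := by
    have a : (V \ W).card ≤ ((W + X) \ W).card := Finset.card_le_card (Finset.sdiff_subset_sdiff hVsub subset_rfl)
    have b := Finset.card_sdiff_add_card_eq_card hWsub
    have a' : ((V \ W).card : ℝ) ≤ ((W + X) \ W).card := by exact_mod_cast a
    have b' : (((W + X) \ W).card : ℝ) + W.card = (W + X).card := by exact_mod_cast b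
    linarith
  have c2 : (W \ V).card = (V \ W).card := Finset.card_sdiff_comm hVc.symm
  have h3 : ‖(ev l x - 1) * tr W id l‖ ≤ 2 * (η * W.card) := by
    rw [h2]
    have n1 : ‖∑ v ∈ V \ W, ev l v‖ ≤ (V \ W).card := norm_tr_le (V \ W) id l
    have n2 : ‖∑ v ∈ W \ V, ev l v‖ ≤ (W \ V).card := norm_tr_le (W \ V) id l
    rw [c2] at n2
    refine (norm_sub_le _ _).trans ?_
    linarith
  rw [norm_mul] at h3
  rw [le_div_iff₀ hρ]
  have hWp : (0 : ℝ) < W.card := by exact_mod_cast hW0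
  have h4 : ‖ev l x - 1‖ * (ρ * W.card) ≤ ‖ev l x - 1‖ * ‖tr W id l‖ := 
    mul_le_mul_of_nonneg_left hl (norm_nonneg _)
  refine le_of_mul_le_mul_right ?_ hWp
  linarith

lemma tr_sq (W : Finset A) (l : Dl A) :
    (tr W id l) ^ 2 = tr (W ×ˢ W) (fun p => p.1 + p.2) l := by
  unfold tr
  rw [sq, Finset.sum_mul_sum, Finset.sum_product]
  simp [ev_add]

lemma spec_core {X W : Finset A} (h0 : (0 : A) ∈ X) {η ρ δ ε L M : ℝ} (hρ : 0 < ρ) (hδ : 0 < δ)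
    (hL : 0 < L) (hρL : ρ ^ 2 = 1 / (2 * L))
    (hη1 : 4 * η / ρ ≤ ε) (hη2 : 2 * η / ρ ≤ δ / 2)
    (hW : ((W + X).card : ℝ) ≤ (1 + η) * W.card) (hW0 : 0 < W.card) 
    (hWW : ((W + W).card : ℝ) ≤ L * W.card) (hWX : (W.card : ℝ) ≤ M * X.card)
    {n : ℕ} (c : Fin n → Dl A) (hc : ∀ i, δ * X.card ≤ ‖tr X id (c i)‖)
    (hsep : ∀ i j, i ≠ j → ∃ x ∈ X, ε < ‖ev (c i) x - ev (c j) x‖) :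
    (n : ℝ) ≤ 8 * L * M / δ ^ 2 := by
  set N : ℝ := (W.card : ℝ) with hN
  have hNp : 0 < N := by rw [hN]; exact_mod_cast hW0
  set x : ℝ := (X.card : ℝ) with hxdef
  have hxp : 0 < x := by rw [hxdef]; exact_mod_cast Finset.card_pos.2 ⟨0, h0⟩
  set h : Dl A → ℝ := fun l => ‖tr W id l‖ ^ 4 - ρ ^ 2 * N ^ 2 * ‖tr W id l‖ ^ 2 with hh
  have contW := (continuous_tr W id).norm
  have contX := (continuous_tr X id).norm
  have conth : Continuous h := by rw [hh]; fun_prop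
  have hle : ∀ l, h l ≤ N ^ 4 := by
    intro l
    have a := norm_tr_le W id l
    have b : ‖tr W id l‖ ^ 4 ≤ N ^ 4 := pow_le_pow_left₀ (norm_nonneg _) a 4
    have : 0 ≤ ρ ^ 2 * N ^ 2 * ‖tr W id l‖ ^ 2 := by positivity
    simp only [hh]; linarith
  have hneg : ∀ l, ‖tr W id l‖ < ρ * N → h l ≤ 0 := by
    intro l hl
    have b : ‖tr W id l‖ ^ 2 ≤ (ρ * N) ^ 2 := pow_le_pow_left₀ (norm_nonneg _) hl.le 2
    have : 0 ≤ ‖tr W id l‖ ^ 2 := by positivity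
    simp only [hh]; nlinarith
  have close : ∀ i χ, ρ * N ≤ ‖tr W id ((c i)⁻¹ * χ)‖ → ∀ y ∈ X, ‖ev (c i) y - ev χ y‖ ≤ 2 * η / ρ := by
    intro i χ hl y hy
    have := large_close h0 hρ hW hW0 hl hy
    rw [ev_mul, ev_inv] at this
    have e : ‖ev (c i) y - ev χ y‖ = ‖ev (c i) y‖ * ‖star (ev (c i) y) * ev χ y - 1‖ := by
      rw [← norm_mul, ← norm_neg]
      congr 1
      have h2 : ev (c i) y * star (ev (c i) y) = 1 := by
        have := Complex.mul_conj (ev (c i) y)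
        rw [Complex.normSq_eq_norm_sq, norm_ev] at this
        simpa using this
      linear_combination (- ev χ y) * h2
    rw [e, norm_ev, one_mul]; exact this
  have point : ∀ χ, (∑ i, h ((c i)⁻¹ * χ)) * ((δ / 2) ^ 2 * x ^ 2) ≤ N ^ 4 * ‖tr X id χ‖ ^ 2 := by
    intro χ
    by_cases hex : ∃ i, ρ * N ≤ ‖tr W id ((c i)⁻¹ * χ)‖
    · obtain ⟨i, hi⟩ := hex
      have s : ∑ j, h ((c j)⁻¹ * χ) ≤ N ^ 4 := by
        rw [← Finset.add_sum_erase _ _ (Finset.mem_univ i)]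
        have : ∑ j ∈ Finset.univ.erase i, h ((c j)⁻¹ * χ) ≤ 0 := by
          refine Finset.sum_nonpos fun j hj => hneg _ ?_
          by_contra! hj2
          obtain ⟨y, hy, hlt⟩ := hsep i j (Finset.ne_of_mem_erase hj).symm
          have a := close i χ hi y hy
          have b := close j χ hj2 y hy
          have t : ‖ev (c i) y - ev (c j) y‖ ≤ ‖ev (c i) y - ev χ y‖ + ‖ev (c j) y - ev χ y‖ := by
            rw [norm_sub_rev (ev (c j) y)]
            exact norm_sub_le_norm_sub_add_norm_sub _ _ _
          have : 4 * η / ρ = 2 * η / ρ + 2 * η / ρ := by ring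
          linarith
        have := hle ((c i)⁻¹ * χ)
        linarith
      have big : δ / 2 * x ≤ ‖tr X id χ‖ := by
        have d : ‖tr X id (c i) - tr X id χ‖ ≤ x * (2 * η / ρ) := by
          unfold tr
          rw [← Finset.sum_sub_distrib]
          refine (norm_sum_le _ _).trans ?_
          refine (Finset.sum_le_card_nsmul _ _ _ (close i χ hi)).trans ?_
          rw [nsmul_eq_mul]
        have a := hc i
        have b := norm_le_norm_add_norm_sub' (tr X id (c i)) (tr X id χ)
        nlinarith
      have big2 : (δ / 2) ^ 2 * x ^ 2 ≤ ‖tr X id χ‖ ^ 2 := by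
        rw [← mul_pow]; exact pow_le_pow_left₀ (by positivity) big 2
      have : 0 ≤ (δ / 2) ^ 2 * x ^ 2 := by positivity
      have : 0 ≤ N ^ 4 := by positivity
      nlinarith
    · push Not at hex
      have s : ∑ j, h ((c j)⁻¹ * χ) ≤ 0 := Finset.sum_nonpos fun j _ => hneg _ (hex j)
      have : 0 ≤ (δ / 2) ^ 2 * x ^ 2 := by positivity
      have : 0 ≤ N ^ 4 * ‖tr X id χ‖ ^ 2 := by positivity
      nlinarith
  have int1 := integral_mono (μ := hm A) (f := fun χ => (∑ i, h ((c i)⁻¹ * χ)) * ((δ / 2) ^ 2 * x ^ 2))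
    (g := fun χ => N ^ 4 * ‖tr X id χ‖ ^ 2) 
    (integrable_of_cont (by fun_prop)) (integrable_of_cont (by fun_prop)) point
  have intS : ∀ i, ∫ χ, h ((c i)⁻¹ * χ) ∂(hm A) = ∫ χ, h χ ∂(hm A) := fun i =>
    integral_mul_left_eq_self h _
  rw [integral_mul_const, integral_const_mul, integral_tr_sq, 
    integral_finsetSum _ (fun i _ => integrable_of_cont (by fun_prop))] at int1
  simp_rw [intS] at int1
  rw [Finset.sum_const, Finset.card_univ, Fintype.card_fin, nsmul_eq_mul] at int1
  have inth : N ^ 3 / (2 * L) ≤ ∫ χ, h χ ∂(hm A) := by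
    have e : ∫ χ, h χ ∂(hm A) = ∫ χ, ‖tr W id χ‖ ^ 4 ∂(hm A) - ρ ^ 2 * N ^ 2 * N := by
      simp only [hh]
      rw [integral_sub (integrable_of_cont (by fun_prop)) (integrable_of_cont (by fun_prop)),
        integral_const_mul, integral_tr_sq]
    have en := energy_ge (W ×ˢ W) (fun p => p.1 + p.2) (W + W) (by
      intro p hp; rw [Finset.mem_product] at hp; exact Finset.add_mem_add hp.1 hp.2)
    have f : ∀ χ : Dl A, ‖tr (W ×ˢ W) (fun p => p.1 + p.2) χ‖ ^ 2 = ‖tr W id χ‖ ^ 4 := by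
      intro χ; rw [← tr_sq, norm_pow]; ring
    simp_rw [f] at en
    rw [Finset.card_product] at en
    push_cast at en
    have pos : 0 ≤ ∫ χ, ‖tr W id χ‖ ^ 4 ∂(hm A) := integral_nonneg fun χ => by positivity
    have g : (N * N) ^ 2 ≤ L * N * ∫ χ, ‖tr W id χ‖ ^ 4 ∂(hm A) := 
      en.trans (mul_le_mul_of_nonneg_right hWW pos)
    have g2 : N ^ 3 / L ≤ ∫ χ, ‖tr W id χ‖ ^ 4 ∂(hm A) := by
      rw [div_le_iff₀ hL]
      refine le_of_mul_le_mul_right ?_ hNp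
      linarith
    rw [e, hρL]
    have : N ^ 3 / (2 * L) = N ^ 3 / L - 1 / (2 * L) * N ^ 2 * N := by field_simp; ring
    linarith
  have fin1 : (n : ℝ) * (N ^ 3 / (2 * L)) * ((δ / 2) ^ 2 * x ^ 2) ≤ N ^ 4 * x := by
    refine le_trans ?_ int1
    gcongr
  rw [le_div_iff₀ (by positivity)]
  have : (n : ℝ) * δ ^ 2 * (N ^ 3 * x) * x ≤ 8 * L * N * (N ^ 3 * x) := by
    have e : (n : ℝ) * (N ^ 3 / (2 * L)) * ((δ / 2) ^ 2 * x ^ 2) = (n * δ ^ 2 * (N ^ 3 * x) * x) / (8 * L) := by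
      field_simp; ring
    rw [e, div_le_iff₀ (by positivity)] at fin1
    linarith
  have h5 : (n : ℝ) * δ ^ 2 * x ≤ 8 * L * N := by
    refine le_of_mul_le_mul_right ?_ (show 0 < N ^ 3 * x by positivity)
    linarith
  refine le_of_mul_le_mul_right ?_ hxp
  have : 8 * L * N ≤ 8 * L * (M * x) := by gcongr
  linarith

end

lemma spec_sep (K : ℕ) (δ ε : ℝ) (hδ : 0 < δ) (hε : 0 < ε) : ∃ m : ℕ, ∀ (A : Type u) [AddCommGroup A]
    [DecidableEq A] (X F : Finset A), (0 : A) ∈ X → X + X ⊆ F + X → F.card ≤ K →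
    ∀ (n : ℕ) (c : Fin n → Dl A), (∀ i, δ * X.card ≤ ‖tr X id (c i)‖) →
    (∀ i j, i ≠ j → ∃ x ∈ X, ε < ‖ev (c i) x - ev (c j) x‖) → n ≤ m := by
  set L : ℝ := 2 ^ (2 * K + 1) with hL
  have hLp : 0 < L := by positivity
  set ρ : ℝ := Real.sqrt (1 / (2 * L)) with hρ
  have hρp : 0 < ρ := Real.sqrt_pos.2 (by positivity)
  have hρ2 : ρ ^ 2 = 1 / (2 * L) := Real.sq_sqrt (by positivity)
  set η : ℝ := ρ * min (ε / 4) (δ / 4) with hη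
  have hηp : 0 < η := by positivity
  obtain ⟨B, hB⟩ := growth_pigeon K η hηp
  refine ⟨⌈8 * L * B / δ ^ 2⌉₊, ?_⟩
  intro A _ _ X F h0 hF hFK n c hc hsep
  obtain ⟨k, hk1, hk2, hk3, hk4⟩ := hB (fun k => (fS X k).card) X.card (Finset.card_pos.2 ⟨0, h0⟩)
    (fun a b h => Finset.card_le_card (fS_mono h0 h)) (by simp [fS_one]) (fS_card hF hFK)
  have hr : η / ρ = min (ε / 4) (δ / 4) := by rw [hη]; field_simp
  have e1 : 4 * η / ρ = 4 * (η / ρ) := by ring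
  have e2 : 2 * η / ρ = 2 * (η / ρ) := by ring
  have m1 := min_le_left (ε / 4) (δ / 4)
  have m2 := min_le_right (ε / 4) (δ / 4)
  have := spec_core (W := fS X k) (M := B) h0 (η := η) (ε := ε) hρp hδ hLp hρ2 (by rw [e1, hr]; linarith) 
    (by rw [e2, hr]; linarith) hk3 (Finset.card_pos.2 ⟨0, ?_⟩) ?_ (by exact_mod_cast hk2) c hc hsep
  · exact_mod_cast this.trans (Nat.le_ceil _)
  · exact fS_mono h0 (Nat.zero_le k) (by simp [fS])
  · rw [← fS_add, ← two_mul, hL]; exact_mod_cast hk4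

end Spec

noncomputable section Bogo
open MeasureTheory

lemma tr_prod {A : Type u} [AddCommGroup A] {ι κ : Type*} (I : Finset ι) (J : Finset κ) (φ : ι → A) 
    (ψ : κ → A) (χ : Dl A) : 
    tr (I ×ˢ J) (fun p => φ p.1 + ψ p.2) χ = tr I φ χ * tr J ψ χ := by
  unfold tr
  rw [Finset.sum_mul_sum, Finset.sum_product]
  simp [ev_add]

variable {R : Type u} [NonUnitalRing R]

/-- the character `t ↦ χ (x t)` -/
def lmul (χ : Dl R) (x : R) : Dl R :=
  mkDl (fun t => ev χ (x * t)) (fun t => norm_ev _ _) (fun s t => by rw [mul_add, ev_add])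

lemma ev_lmul (χ : Dl R) (x t : R) : ev (lmul χ x) t = ev χ (x * t) := rfl

/-- the large spectrum -/
def Sp (X : Finset R) (δ : ℝ) : Set (Dl R) := {χ | δ * X.card ≤ ‖tr X id χ‖}

open Classical in
/-- elements of `X` acting well on `χ` -/
def Ac (X : Finset R) (δ : ℝ) (χ : Dl R) : Finset R := X.filter (fun x => lmul χ x ∈ Sp X δ)

/-- the refined large spectrum -/
def Gs (X : Finset R) (δ : ℝ) : Set (Dl R) := 
  {χ | χ ∈ Sp X δ ∧ δ * X.card ≤ ((Ac X δ χ).card : ℝ)}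

/-- the map used in the weight -/
def phi (t : R) (p : (R × R) × (R × R)) : R := (p.1.1 + p.1.2) + t * (p.2.1 + p.2.2)

/-- fourfold product of `X` -/
def X4 (X : Finset R) : Finset ((R × R) × (R × R)) := (X ×ˢ X) ×ˢ (X ×ˢ X)

lemma norm_tr_phi (X : Finset R) (t : R) (χ : Dl R) : 
    ‖tr (X4 X) (phi t) χ‖ ^ 2 = ‖tr X id χ‖ ^ 4 * ‖tr X id (lmul χ t)‖ ^ 4 := by
  have h : tr (X4 X) (phi t) χ = tr X id χ ^ 2 * tr X id (lmul χ t) ^ 2 := by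
    rw [X4]
    have := tr_prod (X ×ˢ X) (X ×ˢ X) (fun p : R × R => p.1 + p.2) (fun p : R × R => t * (p.1 + p.2)) χ
    refine this.trans ?_
    classical
    rw [tr_sq, tr_sq]
    rfl
  rw [h, norm_mul, norm_pow, norm_pow]
  ring

lemma weight_small {X : Finset R} {δ : ℝ} (hδ : 0 < δ) (hδ1 : δ ≤ 1) {χ : Dl R} (hχ : χ ∉ Gs X δ) :
    ∑ t ∈ X, ‖tr (X4 X) (phi t) χ‖ ^ 2 ≤ 2 * δ * (X.card : ℝ) ^ 7 * ‖tr X id χ‖ ^ 2 := by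
  classical
  simp_rw [norm_tr_phi]
  rw [← Finset.mul_sum]
  set x : ℝ := (X.card : ℝ) with hx
  set a : ℝ := ‖tr X id χ‖ with ha
  have hx0 : 0 ≤ x := by positivity
  have ha0 : 0 ≤ a := norm_nonneg _
  have hax : a ≤ x := norm_tr_le X id χ
  have hb : ∀ t, ‖tr X id (lmul χ t)‖ ^ 4 ≤ x ^ 4 := fun t => 
    pow_le_pow_left₀ (norm_nonneg _) (norm_tr_le X id _) 4
  set s : ℝ := ∑ t ∈ X, ‖tr X id (lmul χ t)‖ ^ 4 with hs
  have hs0 : 0 ≤ s := Finset.sum_nonneg fun t _ => by positivity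
  have hs1 : s ≤ x * x ^ 4 := by
    refine (Finset.sum_le_card_nsmul _ _ _ (fun t _ => hb t)).trans ?_
    rw [nsmul_eq_mul]
  have hd2 : δ ^ 2 ≤ δ := by nlinarith
  by_cases h1 : χ ∈ Sp X δ
  · have h2 : ((Ac X δ χ).card : ℝ) < δ * x := by
      by_contra! h
      exact hχ ⟨h1, h⟩
    have hs2 : s ≤ 2 * δ * x ^ 5 := by
      rw [hs, ← Finset.sum_filter_add_sum_filter_not X (fun t => lmul χ t ∈ Sp X δ)]
      have e1 : ∑ t ∈ X.filter (fun t => lmul χ t ∈ Sp X δ), ‖tr X id (lmul χ t)‖ ^ 4 ≤ δ * x * x ^ 4 := by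
        refine (Finset.sum_le_card_nsmul _ _ _ (fun t _ => hb t)).trans ?_
        rw [nsmul_eq_mul]
        refine mul_le_mul_of_nonneg_right ?_ (by positivity)
        exact h2.le
      have e2 : ∑ t ∈ X.filter (fun t => lmul χ t ∉ Sp X δ), ‖tr X id (lmul χ t)‖ ^ 4 ≤ x * (δ * x) ^ 4 := by
        refine (Finset.sum_le_card_nsmul _ _ ((δ * x) ^ 4) ?_).trans ?_
        · intro t ht
          have := (Finset.mem_filter.1 ht).2
          refine pow_le_pow_left₀ (norm_nonneg _) ?_ 4
          by_contra! h
          exact this h.le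
        · rw [nsmul_eq_mul]
          refine mul_le_mul_of_nonneg_right ?_ (by positivity)
          rw [hx, Nat.cast_le]; exact Finset.card_filter_le _ _
      have e3 : δ ^ 4 * x ^ 5 ≤ δ * x ^ 5 := by
        refine mul_le_mul_of_nonneg_right ?_ (by positivity)
        nlinarith [pow_le_one₀ hδ.le hδ1 (n := 3)]
      nlinarith
    have a4 : a ^ 4 ≤ x ^ 2 * a ^ 2 := by
      have : a ^ 2 ≤ x ^ 2 := pow_le_pow_left₀ ha0 hax 2
      nlinarith [sq_nonneg a]
    calc a ^ 4 * s ≤ (x ^ 2 * a ^ 2) * (2 * δ * x ^ 5) := mul_le_mul a4 hs2 hs0 (by positivity)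
      _ = _ := by ring
  · have h2 : a < δ * x := by
      by_contra! h
      exact h1 h
    have a4 : a ^ 4 ≤ δ * x ^ 2 * a ^ 2 := by
      have : a ^ 2 ≤ (δ * x) ^ 2 := pow_le_pow_left₀ ha0 h2.le 2
      have h3 : (δ * x) ^ 2 ≤ δ * x ^ 2 := by rw [mul_pow]; exact mul_le_mul_of_nonneg_right hd2 (by positivity)
      nlinarith [sq_nonneg a]
    calc a ^ 4 * s ≤ (δ * x ^ 2 * a ^ 2) * (x * x ^ 4) := mul_le_mul a4 hs1 hs0 (by positivity)
      _ = δ * x ^ 7 * a ^ 2 := by ring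
      _ ≤ _ := by
        have : 0 ≤ δ * x ^ 7 * a ^ 2 := by positivity
        linarith

lemma bogo {X Z : Finset R} (h0 : (0 : R) ∈ X) (hsym : ∀ x ∈ X, -x ∈ X)
    (hZ : ∀ x ∈ X, ∀ a ∈ X, ∀ b ∈ X, ∀ c ∈ X, ∀ d ∈ X, ∀ a' ∈ X, ∀ b' ∈ X, ∀ c' ∈ X, ∀ d' ∈ X, 
      (a + b + c + d) + x * (a' + b' + c' + d') ∈ Z) {M : ℝ} (hM1 : 1 ≤ M) 
    (hM : (Z.card : ℝ) ≤ M * X.card) {y : R} 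
    (hy : ∀ γ ∈ Gs X (1 / (12 * M)), ‖ev γ y - 1‖ ≤ 1 / 2) : y ∈ Z := by
  classical
  set δ : ℝ := 1 / (12 * M) with hδ
  have hδp : 0 < δ := by positivity
  have hδ1 : δ ≤ 1 := by rw [hδ, div_le_one (by positivity)]; linarith
  set x : ℝ := (X.card : ℝ) with hx
  have hxp : 0 < x := by rw [hx]; exact_mod_cast Finset.card_pos.2 ⟨0, h0⟩
  have point : ∀ χ : Dl R, 1 / 2 * ∑ t ∈ X, ‖tr (X4 X) (phi t) χ‖ ^ 2 - 3 * δ * x ^ 7 * ‖tr X id χ‖ ^ 2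
      ≤ ∑ t ∈ X, ‖tr (X4 X) (phi t) χ‖ ^ 2 * (ev χ y).re := by
    intro χ
    rw [← Finset.sum_mul]
    have w0 : 0 ≤ ∑ t ∈ X, ‖tr (X4 X) (phi t) χ‖ ^ 2 := Finset.sum_nonneg fun t _ => by positivity
    by_cases hχ : χ ∈ Gs X δ
    · have a := hy χ hχ
      have b := Complex.abs_re_le_norm (ev χ y - 1)
      rw [Complex.sub_re, Complex.one_re] at b
      have c := (abs_le.1 (b.trans a)).1
      have : 0 ≤ 3 * δ * x ^ 7 * ‖tr X id χ‖ ^ 2 := by positivity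
      nlinarith
    · have a := weight_small hδp hδ1 hχ
      have b := Complex.abs_re_le_norm (ev χ y)
      rw [norm_ev] at b
      have c := (abs_le.1 b).1
      nlinarith
  have ct : ∀ t, Continuous (fun χ : Dl R => ‖tr (X4 X) (phi t) χ‖) := fun t => 
    (continuous_tr _ _).norm
  have cX : Continuous (fun χ : Dl R => ‖tr X id χ‖) := (continuous_tr _ _).norm
  have cy : Continuous (fun χ : Dl R => (ev χ y).re) := Complex.continuous_re.comp (continuous_ev y)
  have int1 := integral_mono (μ := hm R) (integrable_of_cont (by fun_prop)) 
    (integrable_of_cont (by fun_prop)) point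
  rw [integral_sub (integrable_of_cont (by fun_prop)) (integrable_of_cont (by fun_prop)),
    integral_const_mul, integral_const_mul, integral_tr_sq, 
    integral_finsetSum _ (fun i _ => integrable_of_cont (by fun_prop)),
    integral_finsetSum _ (fun i _ => integrable_of_cont (by fun_prop))] at int1
  simp_rw [fourier_tr] at int1
  have en : ∀ t ∈ X, x ^ 7 / M ≤ ∫ χ, ‖tr (X4 X) (phi t) χ‖ ^ 2 ∂(hm R) := by
    intro t ht
    have e := energy_ge (X4 X) (phi t) Z (by
      intro p hp
      simp only [X4, Finset.mem_product] at hp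
      have := hZ t ht _ hp.1.1 _ hp.1.2 0 h0 0 h0 _ hp.2.1 _ hp.2.2 0 h0 0 h0
      simp only [add_zero] at this
      exact this)
    have pos : 0 ≤ ∫ χ, ‖tr (X4 X) (phi t) χ‖ ^ 2 ∂(hm R) := integral_nonneg fun χ => by positivity
    have e2 := e.trans (mul_le_mul_of_nonneg_right hM pos)
    have cc : ((X4 X).card : ℝ) = x ^ 4 := by
      rw [X4, Finset.card_product, Finset.card_product]; push_cast; ring
    rw [cc] at e2
    rw [div_le_iff₀ (by linarith)]
    refine le_of_mul_le_mul_right ?_ hxp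
    linarith
  have en2 := Finset.card_nsmul_le_sum X _ _ en
  rw [nsmul_eq_mul] at en2
  have pos : 0 < ∑ t ∈ X, ((((X4 X) ×ˢ (X4 X)).filter (fun p => phi t p.1 - phi t p.2 + y = 0)).card : ℝ) := by
    refine lt_of_lt_of_le ?_ int1
    have e : 1 / 2 * (x * (x ^ 7 / M)) - 3 * δ * x ^ 7 * x = x ^ 8 / (4 * M) := by
      rw [hδ]; field_simp; ring
    have : 0 < x ^ 8 / (4 * M) := by positivity
    linarith
  obtain ⟨t, ht, hne⟩ := Finset.exists_ne_zero_of_sum_ne_zero pos.ne'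
  have hne' : 0 < (((X4 X) ×ˢ (X4 X)).filter (fun p => phi t p.1 - phi t p.2 + y = 0)).card := by
    apply Nat.pos_of_ne_zero; exact_mod_cast hne
  obtain ⟨p, hp⟩ := Finset.card_pos.1 hne'
  simp only [X4, Finset.mem_filter, Finset.mem_product] at hp
  obtain ⟨⟨⟨⟨p1, p2⟩, p3, p4⟩, ⟨q1, q2⟩, q3, q4⟩, heq⟩ := hp
  have := hZ t ht _ q1 _ q2 _ (hsym _ p1) _ (hsym _ p2) _ q3 _ q4 _ (hsym _ p3) _ (hsym _ p4)
  have e : y = phi t p.2 - phi t p.1 := by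
    have := eq_neg_of_add_eq_zero_right heq
    rw [this]; abel
  rw [e]
  convert this using 1
  simp only [phi, mul_add, mul_neg]
  abel

end Bogo

section Coloring
variable {A : Type u} [AddCommGroup A]

/-- finite coloring of a family of characters such that equally coloured ones are close on `S` -/
def Col {ι : Type*} (f : ι → Dl A) (S : Set A) (n : ℕ) (ε : ℝ) : Prop :=
  ∃ c : ι → Fin n, ∀ i j, c i = c j → ∀ x ∈ S, ‖ev (f i) x - ev (f j) x‖ ≤ ε

lemma Col.of_fintype {ι : Type*} {f : ι → Dl A} {S : Set A} {n : ℕ} {ε : ℝ} {κ : Type*} [Fintype κ] 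
    (hκ : Fintype.card κ ≤ n) (c : ι → κ) 
    (h : ∀ i j, c i = c j → ∀ x ∈ S, ‖ev (f i) x - ev (f j) x‖ ≤ ε) : Col f S n ε :=
  ⟨fun i => Fin.castLE hκ (Fintype.equivFin κ (c i)), fun i j hij => h i j (by
    exact (Fintype.equivFin κ).injective (Fin.castLE_injective hκ hij))⟩

lemma col_of_sep {ι : Type*} {f : ι → Dl A} {S : Set A} {m : ℕ} {ε : ℝ} 
    (h : ∀ (n : ℕ) (c : Fin n → ι), (∀ i j, i ≠ j → ∃ x ∈ S, ε < ‖ev (f (c i)) x - ev (f (c j)) x‖) → n ≤ m) :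
    Col f S m (2 * ε) := by
  classical
  set P : ℕ → Prop := fun n => ∃ c : Fin n → ι, ∀ i j, i ≠ j → ∃ x ∈ S, ε < ‖ev (f (c i)) x - ev (f (c j)) x‖ with hP
  have h0 : P 0 := ⟨Fin.elim0, fun i => i.elim0⟩
  have hg : P (Nat.findGreatest P m) := Nat.findGreatest_spec (Nat.zero_le m) h0
  set n := Nat.findGreatest P m with hn
  have hnot : ¬ P (n + 1) := by
    intro hp
    have hle : n + 1 ≤ m := by obtain ⟨c, hc⟩ := hp; exact h _ c hc
    have := Nat.le_findGreatest hle hp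
    omega
  obtain ⟨c, hc⟩ := hg
  have key : ∀ i, ∃ k, ∀ x ∈ S, ‖ev (f i) x - ev (f (c k)) x‖ ≤ ε := by
    intro i
    by_contra! hcon
    apply hnot
    refine ⟨Fin.snoc c i, ?_⟩
    intro a b hab
    induction a using Fin.lastCases with
    | last =>
      induction b using Fin.lastCases with
      | last => exact absurd rfl hab
      | cast b => 
        simpa using hcon b
    | cast a =>
      induction b using Fin.lastCases with
      | last => 
        obtain ⟨x, hx, hlt⟩ := hcon a
        refine ⟨x, hx, ?_⟩
        rw [norm_sub_rev]
        simpa using hlt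
      | cast b => 
        simpa using hc a b (fun e => hab (by rw [e]))
  choose k hk using key
  refine Col.of_fintype (κ := Fin n) (by simpa using Nat.findGreatest_le m) k ?_
  intro i j hij x hx
  have a := hk i x hx
  have b := hk j x hx
  rw [← hij, norm_sub_rev] at b
  have := norm_sub_le_norm_sub_add_norm_sub (ev (f i) x) (ev (f (c (k i))) x) (ev (f j) x)
  linarith

lemma circle_col (ε : ℝ) (hε : 0 < ε) : ∃ n : ℕ, 0 < n ∧ ∃ q : ℂ → Fin n, ∀ z w, ‖z‖ = 1 → ‖w‖ = 1 → 
    q z = q w → ‖z - w‖ ≤ ε := by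
  obtain ⟨t, ht, hfin, hcov⟩ := (isCompact_sphere (0 : ℂ) 1).finite_cover_balls (half_pos hε)
  have hne : t.Nonempty := by
    have : (1 : ℂ) ∈ Metric.sphere (0 : ℂ) 1 := by simp
    obtain ⟨s, hs, _⟩ := Set.mem_iUnion₂.1 (hcov this)
    exact ⟨s, hs⟩
  have := hfin.fintype
  have key : ∀ z : ℂ, ∃ s : t, ‖z‖ = 1 → ‖z - s‖ < ε / 2 := by
    intro z
    by_cases hz : ‖z‖ = 1
    · obtain ⟨s, hs, h⟩ := Set.mem_iUnion₂.1 (hcov (show z ∈ Metric.sphere (0 : ℂ) 1 by simpa using hz))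
      exact ⟨⟨s, hs⟩, fun _ => by simpa [dist_eq_norm] using h⟩
    · obtain ⟨s, hs⟩ := hne
      exact ⟨⟨s, hs⟩, fun h => absurd h hz⟩
  choose s hs using key
  have : Nonempty t := hne.to_subtype
  refine ⟨Fintype.card t, Fintype.card_pos, fun z => Fintype.equivFin t (s z), ?_⟩
  intro z w hz hw h
  have e := (Fintype.equivFin t).injective h
  have a := hs z hz
  have b := hs w hw
  rw [← e, norm_sub_rev] at b
  have := norm_sub_le_norm_sub_add_norm_sub z (s z) w
  linarith

lemma Col.extend (n m : ℕ) (ε : ℝ) (hε : 0 < ε) : ∃ N : ℕ, ∀ (A : Type u) [AddCommGroup A] (ι : Type u) 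
    (f : ι → Dl A) (S Q : Set A) (E : Finset A), E.card ≤ m → Q ⊆ (E : Set A) + S → Col f S n ε → 
    Col f Q N (2 * ε) := by
  obtain ⟨q0, hq0, q, hq⟩ := circle_col ε hε
  refine ⟨n * q0 ^ m, ?_⟩
  rintro A _ ι f S Q E hE hQ ⟨c, hc⟩
  classical
  refine Col.of_fintype (κ := Fin n × (E → Fin q0)) ?_ (fun i => (c i, fun e => q (ev (f i) e))) ?_
  · simp
    exact Nat.mul_le_mul_left _ (Nat.pow_le_pow_right hq0 hE)
  · intro i j hij x hx
    obtain ⟨e, he, s, hs, rfl⟩ := hQ hx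
    have a := hc i j (congrArg Prod.fst hij) s hs
    have b := hq _ _ (norm_ev _ _) (norm_ev _ _) (congrFun (congrArg Prod.snd hij) ⟨e, he⟩)
    simp only at b
    simp only [ev_add]
    have e1 : ev (f i) e * ev (f i) s - ev (f j) e * ev (f j) s = 
      ev (f i) e * (ev (f i) s - ev (f j) s) + (ev (f i) e - ev (f j) e) * ev (f j) s := by ring
    rw [e1]
    refine (norm_add_le _ _).trans ?_
    rw [norm_mul, norm_mul, norm_ev, norm_ev]
    linarith

lemma spec_col (K : ℕ) (δ ε : ℝ) (hδ : 0 < δ) (hε : 0 < ε) : ∃ m : ℕ, ∀ (R : Type u) [NonUnitalRing R]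
    [DecidableEq R] (X F : Finset R), (0 : R) ∈ X → X + X ⊆ F + X → F.card ≤ K →
    Col (fun χ : Sp X δ => (χ : Dl R)) (X : Set R) m ε := by
  obtain ⟨m, hm⟩ := spec_sep.{u} K δ (ε / 2) hδ (by linarith)
  refine ⟨m, ?_⟩
  intro R _ _ X F h0 hF hK
  have := col_of_sep (f := fun χ : Sp X δ => (χ : Dl R)) (S := (X : Set R)) (m := m) (ε := ε / 2) ?_
  · rwa [show 2 * (ε / 2) = ε by ring] at this
  · intro n c hc
    exact hm R X F h0 hF hK n (fun i => c i) (fun i => (c i).2) hc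

end Coloring

section Cover
variable {R : Type u} [NonUnitalRing R]

/-- `S` is covered by `n` translates of `A` -/
def Cov (n : ℕ) (S A : Set R) : Prop := ∃ E : Finset R, E.card ≤ n ∧ S ⊆ (E : Set R) + A

/-- iterated sumset -/
def sS (X : Set R) : ℕ → Set R
  | 0 => {0}
  | k + 1 => sS X k + X

lemma sS_one (X : Set R) : sS X 1 = X := by simp [sS]

lemma sS_add (X : Set R) (a b : ℕ) : sS X (a + b) = sS X a + sS X b := by
  induction b with
  | zero => simp [sS]
  | succ b ih => rw [← add_assoc, sS, ih, sS, add_assoc]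

lemma sS_two (X : Set R) : sS X 2 = X + X := by rw [sS_add X 1 1, sS_one]

lemma sS_sS (X : Set R) (a b : ℕ) : sS (sS X a) b = sS X (a * b) := by
  induction b with
  | zero => simp [sS]
  | succ b ih => rw [sS, ih, mul_add, sS_add, mul_one]

lemma sS_mono {X : Set R} (h0 : (0 : R) ∈ X) {a b : ℕ} (h : a ≤ b) : sS X a ⊆ sS X b := by
  induction h with
  | refl => exact subset_rfl
  | step _ ih => 
    intro x hx
    exact ⟨x, ih hx, 0, h0, add_zero x⟩

lemma sS_subset {X Y : Set R} (h : X ⊆ Y) (a : ℕ) : sS X a ⊆ sS Y a := by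
  induction a with
  | zero => exact subset_rfl
  | succ a ih => exact Set.add_subset_add ih h

lemma mul_sS (A B : Set R) (j : ℕ) : A * sS B j ⊆ sS (A * B) j := by
  induction j with
  | zero => rintro _ ⟨a, _, b, hb, rfl⟩; simp [sS] at hb ⊢; simp [hb]
  | succ j ih => exact (Set.mul_add_subset ..).trans (Set.add_subset_add_right ih)

lemma sS_mul (A B : Set R) (j : ℕ) : sS B j * A ⊆ sS (B * A) j := by
  induction j with
  | zero => rintro _ ⟨a, ha, b, hb, rfl⟩; simp [sS] at ha ⊢; simp [ha]
  | succ j ih => exact (Set.add_mul_subset ..).trans (Set.add_subset_add_right ih)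

lemma Cov.mono {n m : ℕ} {S S' A A' : Set R} (h : Cov n S A) (hn : n ≤ m) (hS : S' ⊆ S) (hA : A ⊆ A') : 
    Cov m S' A' := by
  obtain ⟨E, h1, h2⟩ := h
  exact ⟨E, h1.trans hn, hS.trans (h2.trans (Set.add_subset_add_left hA))⟩

lemma Cov.refl (A : Set R) : Cov 1 A A := ⟨{0}, by simp, by simp⟩

lemma Cov.trans {n m : ℕ} {S A B : Set R} (h : Cov n S A) (h' : Cov m A B) : Cov (n * m) S B := by
  classical
  obtain ⟨E, h1, h2⟩ := h
  obtain ⟨E', h1', h2'⟩ := h'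
  refine ⟨E + E', Finset.card_add_le.trans (Nat.mul_le_mul h1 h1'), ?_⟩
  rw [Finset.coe_add, add_assoc]
  exact h2.trans (Set.add_subset_add_left h2')

lemma Cov.add {n m : ℕ} {S A S' A' : Set R} (h : Cov n S A) (h' : Cov m S' A') : 
    Cov (n * m) (S + S') (A + A') := by
  classical
  obtain ⟨E, h1, h2⟩ := h
  obtain ⟨E', h1', h2'⟩ := h'
  refine ⟨E + E', Finset.card_add_le.trans (Nat.mul_le_mul h1 h1'), ?_⟩
  rw [Finset.coe_add, add_add_add_comm]
  exact Set.add_subset_add h2 h2'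

lemma Cov.sSk {n : ℕ} {S A : Set R} (h : Cov n S A) (j : ℕ) : Cov (n ^ j) (sS S j) (sS A j) := by
  induction j with
  | zero => exact Cov.refl _
  | succ j ih => exact ih.add h

lemma Cov.union {n m : ℕ} {S S' A : Set R} (h : Cov n S A) (h' : Cov m S' A) : 
    Cov (n + m) (S ∪ S') A := by
  classical
  obtain ⟨E, h1, h2⟩ := h
  obtain ⟨E', h1', h2'⟩ := h'
  refine ⟨E ∪ E', (Finset.card_union_le _ _).trans (Nat.add_le_add h1 h1'), ?_⟩
  rw [Finset.coe_union, Set.union_add]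
  exact Set.union_subset_union h2 h2'

lemma Cov.biUnion {ι : Type*} {n m : ℕ} {S A : Set R} (I : Finset ι) (T : ι → Set R) (hI : I.card ≤ m)
    (hS : S ⊆ ⋃ i ∈ I, T i) (h : ∀ i ∈ I, Cov n (T i) A) : Cov (m * n) S A := by
  classical
  choose! E h1 h2 using h
  refine ⟨I.biUnion E, Finset.card_biUnion_le.trans ?_, ?_⟩
  · exact (Finset.sum_le_card_nsmul _ _ n h1).trans (by rw [smul_eq_mul]; exact Nat.mul_le_mul_right _ hI)
  · intro x hx
    obtain ⟨i, hi, hxi⟩ := Set.mem_iUnion₂.1 (hS hx)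
    obtain ⟨e, he, a, ha, rfl⟩ := h2 i hi hxi
    exact ⟨e, by simpa using ⟨i, hi, he⟩, a, ha, rfl⟩

lemma cov_reduce {K : ℕ} {X : Set R} (h : Cov K (X + X) X) (k : ℕ) : Cov (K ^ k) (sS X (k + 2)) (sS X 2) := by
  induction k with
  | zero => exact Cov.refl _
  | succ k ih =>
    have h3 : Cov K (sS X 3) (sS X 2) := by
      rw [show sS X 3 = sS X (1 + 2) from rfl, sS_add, sS_one, sS_two]
      have := (Cov.refl X).add h
      rwa [one_mul] at this
    have h1 : Cov (K ^ k * 1) (sS X (k + 1 + 2)) (sS X 3) := ih.add (Cov.refl X)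
    rw [mul_one] at h1
    exact h1.trans h3

/-- the set `4X + X·4X` -/
def ZZ (X : Set R) : Set R := (X + X + X + X) + X * (X + X + X + X)

lemma sS_four (X : Set R) : sS X 4 = X + X + X + X := by simp [sS]

lemma ZZ_eq (X : Set R) : ZZ X = sS X 4 + X * sS X 4 := by rw [sS_four, ZZ]

lemma sS4_sub_ZZ {X : Set R} (h0 : (0 : R) ∈ X) : sS X 4 ⊆ ZZ X := by
  rw [ZZ_eq]
  intro x hx
  have : (0 : R) ∈ sS X 4 := sS_mono h0 (Nat.zero_le 4) (by simp [sS])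
  exact ⟨x, hx, 0, ⟨0, h0, 0, this, by simp⟩, add_zero x⟩

lemma sS_neg {X : Set R} (h : ∀ x ∈ X, -x ∈ X) (k : ℕ) : ∀ x ∈ sS X k, -x ∈ sS X k := by
  induction k with
  | zero => simp [sS]
  | succ k ih =>
    rintro _ ⟨a, ha, b, hb, rfl⟩
    exact ⟨-a, ih a ha, -b, h b hb, by simp; abel⟩

lemma ZZ_neg {X : Set R} (h : ∀ x ∈ X, -x ∈ X) : ∀ x ∈ ZZ X, -x ∈ ZZ X := by
  rw [ZZ_eq]
  rintro _ ⟨a, ha, _, ⟨b, hb, c, hc, rfl⟩, rfl⟩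
  exact ⟨-a, sS_neg h 4 a ha, b * (-c), ⟨b, hb, -c, sS_neg h 4 c hc, rfl⟩, by simp; abel⟩

section
variable {K : ℕ} {X : Set R} 

lemma ZZ_sub (X : Set R) : ZZ X ⊆ sS X 4 + sS (X * X) 4 := by
  rw [ZZ_eq]; exact Set.add_subset_add_left (mul_sS _ _ _)

lemma cov_ZZ (hm : Cov K (X * X) X) : Cov (K ^ 4) (ZZ X) (sS X 8) := by
  have := (Cov.refl (sS X 4)).add (hm.sSk 4)
  rw [one_mul, ← sS_add] at this
  exact this.mono le_rfl (ZZ_sub X) subset_rfl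

lemma cov_2ZZ (ha : Cov K (X + X) X) (hm : Cov K (X * X) X) : Cov (K ^ 22) (ZZ X + ZZ X) (sS X 2) := by
  have h := ((cov_ZZ hm).add (cov_ZZ hm))
  rw [← sS_add] at h
  have := h.trans (cov_reduce ha 14)
  rwa [← pow_add, ← pow_add] at this

lemma cov_ZZZZ (hK : 1 ≤ K) (hneg : ∀ x ∈ X, -x ∈ X) (ha : Cov K (X + X) X) (hm : Cov K (X * X) X) : 
    Cov (K ^ 510) (ZZ X * ZZ X) (sS X 2) := by
  classical
  obtain ⟨F, hF1, hF2⟩ := hm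
  set F1 : Finset R := F.filter (fun f => ∃ a ∈ X, ∃ b ∈ X, ∃ c ∈ X, f = a * b + c) with hF1def
  have F1c : F1.card ≤ K := (Finset.card_filter_le _ _).trans hF1
  have F1cov : X * X ⊆ (F1 : Set R) + X := by
    rintro _ ⟨a, ha, b, hb, rfl⟩
    obtain ⟨f, hf, x, hx, h⟩ := hF2 (Set.mul_mem_mul ha hb)
    refine ⟨f, ?_, x, hx, h⟩
    rw [hF1def, Finset.coe_filter]
    refine ⟨hf, a, ha, b, hb, -x, hneg x hx, ?_⟩
    simp only at h
    rw [← h]; abel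
  have hm' : Cov K (X * X) X := ⟨F1, F1c, F1cov⟩
  have trans1 : ∀ g : R, Cov 1 {g} {0} := fun g => ⟨{g}, by simp, by simp⟩
  have fX : ∀ f ∈ F1, Cov (K ^ 3) ({f} * X) (sS X 2) ∧ Cov (K ^ 3) (X * {f}) (sS X 2) := by
    intro f hf
    obtain ⟨_, a, ha', b, hb', c, hc', rfl⟩ := Finset.mem_filter.1 hf
    constructor
    · have s1 : Cov K ({a} * (F1 : Set R)) {0} := 
        ⟨F1.image (fun f => a * f), Finset.card_image_le.trans F1c, by simp⟩
      have s2 : Cov K ({a} * X) X := hm'.mono le_rfl (Set.mul_subset_mul_right (by simpa using ha')) subset_rfl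
      have s3 : Cov K ({c} * X) X := hm'.mono le_rfl (Set.mul_subset_mul_right (by simpa using hc')) subset_rfl
      have := (s1.add s2).add s3
      rw [sS_two]
      refine this.mono (by ring_nf; exact le_rfl) ?_ (by simp)
      rintro _ ⟨_, rfl, x, hx, rfl⟩
      obtain ⟨f', hf', x', hx', h⟩ := F1cov (Set.mul_mem_mul hb' hx)
      refine ⟨a * f' + a * x', ⟨a * f', ⟨a, rfl, f', hf', rfl⟩, a * x', ⟨a, rfl, x', hx', rfl⟩, rfl⟩, 
        c * x, ⟨c, rfl, x, hx, rfl⟩, ?_⟩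
      simp only at h ⊢
      rw [← mul_add, h, add_mul, mul_assoc]
    · have s1 : Cov K ((F1 : Set R) * {b}) {0} := 
        ⟨F1.image (fun f => f * b), Finset.card_image_le.trans F1c, by simp⟩
      have s2 : Cov K (X * {b}) X := hm'.mono le_rfl (Set.mul_subset_mul_left (by simpa using hb')) subset_rfl
      have s3 : Cov K (X * {c}) X := hm'.mono le_rfl (Set.mul_subset_mul_left (by simpa using hc')) subset_rfl
      have := (s1.add s2).add s3
      rw [sS_two]
      refine this.mono (by ring_nf; exact le_rfl) ?_ (by simp)
      rintro _ ⟨x, hx, _, rfl, rfl⟩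
      obtain ⟨f', hf', x', hx', h⟩ := F1cov (Set.mul_mem_mul hx ha')
      refine ⟨f' * b + x' * b, ⟨f' * b, ⟨f', hf', b, rfl, rfl⟩, x' * b, ⟨x', hx', b, rfl, rfl⟩, rfl⟩, 
        x * c, ⟨x, hx, c, rfl, rfl⟩, ?_⟩
      simp only at h ⊢
      rw [← add_mul, h, mul_add, mul_assoc]
  have gX : ∀ (n : ℕ), ∀ g ∈ sS (F1 : Set R) n, Cov ((K ^ 3) ^ n) ({g} * X) (sS X (2 * n)) ∧ 
      Cov ((K ^ 3) ^ n) (X * {g}) (sS X (2 * n)) := by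
    intro n
    induction n with
    | zero => 
      intro g hg
      simp only [sS, Set.mem_singleton_iff] at hg
      subst hg
      constructor
      · refine (Cov.refl _).mono le_rfl ?_ subset_rfl
        rintro _ ⟨_, rfl, x, _, rfl⟩; simp [sS]
      · refine (Cov.refl _).mono le_rfl ?_ subset_rfl
        rintro _ ⟨x, _, _, rfl, rfl⟩; simp [sS]
    | succ n ih =>
      rintro _ ⟨g, hg, f, hf, rfl⟩
      rw [pow_succ, mul_add, sS_add]
      constructor
      · refine ((ih g hg).1.add (fX f hf).1).mono le_rfl ?_ subset_rfl
        rintro _ ⟨_, rfl, x, hx, rfl⟩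
        exact ⟨g * x, ⟨g, rfl, x, hx, rfl⟩, f * x, ⟨f, rfl, x, hx, rfl⟩, (add_mul _ _ _).symm⟩
      · refine ((ih g hg).2.add (fX f hf).2).mono le_rfl ?_ subset_rfl
        rintro _ ⟨x, hx, _, rfl, rfl⟩
        exact ⟨x * g, ⟨x, hx, g, rfl, rfl⟩, x * f, ⟨x, hx, f, rfl, rfl⟩, (mul_add _ _ _).symm⟩
  have gS : ∀ g ∈ sS (F1 : Set R) 4, Cov (K ^ 96) ({g} * sS X 8) (sS X 64) ∧ 
      Cov (K ^ 96) (sS X 8 * {g}) (sS X 64) := by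
    intro g hg
    obtain ⟨a1, a2⟩ := gX 4 g hg
    have b1 := a1.sSk 8
    have b2 := a2.sSk 8
    rw [sS_sS, ← pow_mul, ← pow_mul] at b1 b2
    exact ⟨b1.mono le_rfl (mul_sS _ _ _) subset_rfl, b2.mono le_rfl (sS_mul _ _ _) subset_rfl⟩
  have SS : Cov (K ^ 64) (sS X 8 * sS X 8) (sS X 64) := by
    refine (hm'.sSk 64).mono le_rfl ?_ subset_rfl
    refine (mul_sS _ _ _).trans ((sS_subset (sS_mul _ _ _) 8).trans ?_)
    rw [sS_sS]
  -- finite G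
  have Gfin : ∀ n, ∃ G : Finset R, G.card ≤ K ^ n ∧ (G : Set R) = sS (F1 : Set R) n := by
    intro n
    induction n with
    | zero => exact ⟨{0}, by simp, by simp [sS]⟩
    | succ n ih =>
      obtain ⟨G, h1, h2⟩ := ih
      exact ⟨G + F1, Finset.card_add_le.trans (by rw [pow_succ]; exact Nat.mul_le_mul h1 F1c), by 
        rw [Finset.coe_add, h2]; rfl⟩
  obtain ⟨G, hG1, hG2⟩ := Gfin 4
  have Zsub : ZZ X ⊆ (G : Set R) + sS X 8 := by
    refine (ZZ_sub X).trans ?_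
    have h1 : sS (X * X) 4 ⊆ sS (F1 : Set R) 4 + sS X 4 := by
      have : ∀ n, sS (X * X) n ⊆ sS (F1 : Set R) n + sS X n := by
        intro n
        induction n with
        | zero => simp [sS]
        | succ n ih =>
          have := Set.add_subset_add ih F1cov
          rw [add_add_add_comm] at this
          exact this
      exact this 4
    rw [hG2]
    calc sS X 4 + sS (X * X) 4 ⊆ sS X 4 + (sS (F1 : Set R) 4 + sS X 4) := Set.add_subset_add_left h1
      _ = _ := by rw [show (8 : ℕ) = 4 + 4 from rfl, sS_add X 4 4]; abel
  have big : Cov (K ^ 8 * K ^ 256) (ZZ X * ZZ X) (sS X 192) := by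
    refine Cov.biUnion (G ×ˢ G) (fun p => {p.1 * p.2} + ({p.1} * sS X 8) + (sS X 8 * {p.2}) + sS X 8 * sS X 8) ?_ ?_ ?_
    · rw [Finset.card_product]
      calc _ ≤ K ^ 4 * K ^ 4 := Nat.mul_le_mul hG1 hG1
        _ = _ := by rw [← pow_add]
    · rintro _ ⟨z, hz, z', hz', rfl⟩
      obtain ⟨g, hg, s, hs, rfl⟩ := Zsub hz
      obtain ⟨g', hg', s', hs', rfl⟩ := Zsub hz'
      refine Set.mem_iUnion₂.2 ⟨(g, g'), Finset.mem_product.2 ⟨hg, hg'⟩, ?_⟩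
      refine ⟨g * g' + g * s' + s * g', ⟨g * g' + g * s', ⟨g * g', rfl, g * s', ⟨g, rfl, s', hs', rfl⟩, rfl⟩, 
        s * g', ⟨s, hs, g', rfl, rfl⟩, rfl⟩, s * s', ⟨s, hs, s', hs', rfl⟩, ?_⟩
      simp only [add_mul, mul_add]; abel
    · rintro ⟨g, g'⟩ hp
      obtain ⟨hg, hg'⟩ := Finset.mem_product.1 hp
      have hg2 : g ∈ sS (F1 : Set R) 4 := by rw [← hG2]; exact hg
      have hg2' : g' ∈ sS (F1 : Set R) 4 := by rw [← hG2]; exact hg'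
      have := (((trans1 (g * g')).add (gS g hg2).1).add (gS g' hg2').2).add SS
      rw [one_mul, ← pow_add, ← pow_add, Set.singleton_zero, zero_add, ← sS_add, ← sS_add] at this
      exact this
  have := big.trans (cov_reduce ha 190)
  rw [← pow_add, ← pow_add] at this
  exact this.mono (Nat.pow_le_pow_right hK (by norm_num)) subset_rfl subset_rfl

lemma cov_inter {n : ℕ} {S X Z : Set R} (hneg : ∀ x ∈ X, -x ∈ X) (hZ : sS X 4 ⊆ Z) (T : AddSubgroup R) 
    (h : Cov n S (sS X 2)) : Cov n (S ∩ T) (Z ∩ T) := by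
  classical
  obtain ⟨E, h1, h2⟩ := h
  have key : ∀ g : R, ∃ t : R, ∀ y ∈ T, (∃ s ∈ sS X 2, y = g + s) → t ∈ T ∧ ∃ s ∈ sS X 2, t = g + s := by
    intro g
    by_cases hg : ∃ y ∈ T, ∃ s ∈ sS X 2, y = g + s
    · obtain ⟨y, hy, hs⟩ := hg
      exact ⟨y, fun _ _ _ => ⟨hy, hs⟩⟩
    · exact ⟨0, fun y hy hs => absurd ⟨y, hy, hs⟩ hg⟩
  choose t ht using key
  refine ⟨E.image t, Finset.card_image_le.trans h1, ?_⟩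
  rintro y ⟨hyS, hyT⟩
  obtain ⟨g, hg, s, hs, hgs⟩ := h2 hyS
  obtain ⟨k1, s', hs', k2⟩ := ht g y hyT ⟨s, hs, hgs.symm⟩
  refine ⟨t g, by simpa using ⟨g, hg, rfl⟩, y - t g, ⟨hZ ?_, T.sub_mem hyT k1⟩, by simp⟩
  rw [k2, ← hgs, show sS X 4 = sS X (2 + 2) from rfl, sS_add]
  exact ⟨s, hs, -s', sS_neg hneg 2 s' hs', by simp; abel⟩

end
end Cover

section Alg
variable {R : Type u} [NonUnitalRing R] {V : Type} [NormedAddCommGroup V] [NormedSpace ℝ V] 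

/-- Data for a local homomorphism to a normed space. -/
structure Dat (J : Set R) (Ψ : R → V) (e0 e1 : ℝ) : Prop where
  e1pos : 0 < e1
  e10 : e1 ≤ e0
  zero : (0 : R) ∈ J
  neg : ∀ y ∈ J, -y ∈ J
  bd : ∀ y ∈ J, ‖Ψ y‖ ≤ e0
  add : ∀ y ∈ J, ∀ z ∈ J, Ψ (y + z) = Ψ y + Ψ z
  mem : ∀ y ∈ J, ∀ z ∈ J, ‖Ψ (y + z)‖ ≤ e0 → y + z ∈ J
  mul : ∀ a ∈ J, ∀ b ∈ J, ‖Ψ a‖ ≤ e1 → ‖Ψ b‖ ≤ e1 → a * b ∈ J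

namespace Dat
variable {J : Set R} {Ψ : R → V} {e0 e1 : ℝ}

lemma map_zero (D : Dat J Ψ e0 e1) : Ψ 0 = 0 := by
  have := D.add 0 D.zero 0 D.zero
  rw [add_zero] at this
  simpa using this

lemma map_neg (D : Dat J Ψ e0 e1) {y : R} (hy : y ∈ J) : Ψ (-y) = - Ψ y := by
  have := D.add y hy _ (D.neg y hy)
  rw [add_neg_cancel, D.map_zero] at this
  exact (neg_eq_of_add_eq_zero_right this.symm).symm

lemma nsmul (D : Dat J Ψ e0 e1) {y : R} (hy : y ∈ J) {n : ℕ} (hn : n * ‖Ψ y‖ ≤ e0) : 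
    ∀ j ≤ n, j • y ∈ J ∧ Ψ (j • y) = j • Ψ y := by
  intro j
  induction j with
  | zero => intro _; simp [D.zero, D.map_zero]
  | succ j ih =>
    intro hj
    obtain ⟨a, b⟩ := ih (by omega)
    have e : Ψ (j • y + y) = (j + 1) • Ψ y := by rw [D.add _ a _ hy, b, succ_nsmul]
    rw [succ_nsmul]
    refine ⟨D.mem _ a _ hy ?_, e⟩
    rw [e]
    refine (norm_nsmul_le).trans ?_
    refine le_trans ?_ hn
    have : ((j + 1 : ℕ) : ℝ) ≤ n := by exact_mod_cast hj
    exact mul_le_mul_of_nonneg_right this (norm_nonneg _)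

lemma trap (D : Dat J Ψ e0 e1) {z : R} {k : ℕ} (h : ∀ j ≤ k, j • z ∈ J) : Ψ (k • z) = k • Ψ z := by
  induction k with
  | zero => simp [D.map_zero]
  | succ k ih =>
    have h1 : z ∈ J := by simpa using h 1 (by omega)
    rw [succ_nsmul, D.add _ (h k (by omega)) _ h1, ih (fun j hj => h j (by omega)), succ_nsmul]

lemma norm_nat_smul (k : ℕ) (v : V) : ‖k • v‖ = k * ‖v‖ := by
  rw [← Nat.cast_smul_eq_nsmul ℝ, norm_smul]; simp

lemma contr (D : Dat J Ψ e0 e1) (B : R →+ R →+ R) 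
    (hB : ∀ a ∈ J, ∀ b ∈ J, ‖Ψ a‖ ≤ e1 → ‖Ψ b‖ ≤ e1 → B a b ∈ J) {L : ℕ} (hL : 4 * e0 ≤ L * e1) 
    {a y : R} (ha : a ∈ J) (hy : y ∈ J) (hae : L * ‖Ψ a‖ ≤ e1) (hye : ‖Ψ y‖ ≤ e1) : 
    B a y ∈ J ∧ ‖Ψ (B a y)‖ ≤ 1 / 2 * ‖Ψ y‖ := by
  have e1p := D.e1pos
  have e10 := D.e10
  have hLp : (4 : ℝ) ≤ L := by nlinarith
  have hL1 : 1 ≤ L := by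
    have : (1 : ℝ) ≤ L := by linarith
    exact_mod_cast this
  have sa : ∀ i ≤ L, i • a ∈ J ∧ ‖Ψ (i • a)‖ ≤ e1 := by
    intro i hi
    obtain ⟨p, q⟩ := D.nsmul ha (hae.trans e10) i hi
    refine ⟨p, ?_⟩
    rw [q, norm_nat_smul]
    refine le_trans ?_ hae
    exact mul_le_mul_of_nonneg_right (by exact_mod_cast hi) (norm_nonneg _)
  have key : ∀ k : ℕ, k * ‖Ψ y‖ ≤ e1 → (L * k) * ‖Ψ (B a y)‖ ≤ e0 := by
    intro k hk
    have sy : ∀ i ≤ k, i • y ∈ J ∧ ‖Ψ (i • y)‖ ≤ e1 := by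
      intro i hi
      obtain ⟨p, q⟩ := D.nsmul hy (hk.trans e10) i hi
      refine ⟨p, ?_⟩
      rw [q, norm_nat_smul]
      refine le_trans ?_ hk
      exact mul_le_mul_of_nonneg_right (by exact_mod_cast hi) (norm_nonneg _)
    have a1 := sa 1 hL1
    rw [one_nsmul] at a1
    have t1 : Ψ (k • B a y) = k • Ψ (B a y) := D.trap (fun j hj => by
      rw [← AddMonoidHom.map_nsmul]
      exact hB _ a1.1 _ (sy j hj).1 a1.2 (sy j hj).2)
    have hall : ∀ i ≤ L, i • (k • B a y) ∈ J := fun i hi => by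
      rw [← AddMonoidHom.map_nsmul, ← AddMonoidHom.nsmul_apply, ← AddMonoidHom.map_nsmul]
      exact hB _ (sa i hi).1 _ (sy k le_rfl).1 (sa i hi).2 (sy k le_rfl).2
    have t2 : Ψ (L • (k • B a y)) = L • Ψ (k • B a y) := D.trap hall
    have := D.bd _ (hall L le_rfl)
    rw [t2, t1, norm_nat_smul, norm_nat_smul] at this
    linarith
  constructor
  · have a1 := sa 1 hL1
    rw [one_nsmul] at a1
    exact hB _ a1.1 _ hy a1.2 hye
  · by_cases h0 : ‖Ψ y‖ = 0
    · rw [h0, mul_zero]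
      by_contra! hc
      obtain ⟨k, hk⟩ := exists_nat_gt (e0 / ‖Ψ (B a y)‖)
      rw [div_lt_iff₀ hc] at hk
      have := key k (by rw [h0]; linarith)
      have : (k : ℝ) * ‖Ψ (B a y)‖ ≤ L * k * ‖Ψ (B a y)‖ := by
        have : 0 ≤ (k : ℝ) * ‖Ψ (B a y)‖ := by positivity
        nlinarith
      linarith
    · have hp : 0 < ‖Ψ y‖ := lt_of_le_of_ne (norm_nonneg _) (Ne.symm h0)
      set k := ⌊e1 / ‖Ψ y‖⌋₊ with hk
      have k1 : (k : ℝ) * ‖Ψ y‖ ≤ e1 := by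
        rw [← le_div_iff₀ hp]; exact Nat.floor_le (by positivity)
      have k2 : 1 ≤ k := by
        rw [hk, Nat.le_floor_iff (by positivity), Nat.cast_one, le_div_iff₀ hp]; linarith
      have k3 : e1 < (k + 1) * ‖Ψ y‖ := by
        rw [← div_lt_iff₀ hp]; exact Nat.lt_floor_add_one _
      have k4 := key k k1
      have k5 : (1 : ℝ) ≤ k := by exact_mod_cast k2
      have k6 : e1 ≤ 2 * k * ‖Ψ y‖ := by nlinarith
      have k7 : (L * k : ℝ) * ‖Ψ (B a y)‖ ≤ (L * k) * (1 / 2 * ‖Ψ y‖) := by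
        have : (L : ℝ) * e1 ≤ L * (2 * k * ‖Ψ y‖) := by gcongr
        nlinarith
      exact le_of_mul_le_mul_left k7 (by positivity)

lemma neg_smul_mem (D : Dat J Ψ e0 e1) {u : R} (hu : u ∈ J) {c : ℤ} (hc : -1 ≤ c ∧ c ≤ 1) : 
    c • u ∈ J ∧ Ψ (c • u) = c • Ψ u := by
  have : c = -1 ∨ c = 0 ∨ c = 1 := by omega
  rcases this with rfl | rfl | rfl
  · simp [D.neg u hu, D.map_neg hu]
  · simp [D.zero, D.map_zero]
  · simp [hu]

/-- simultaneous control of `w` and `w * a` -/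
def Good (J : Set R) (Ψ : R → V) (a w : R) (p q : V) : Prop := w ∈ J ∧ Ψ w = p ∧ Ψ (w * a) = q

lemma good_add (D : Dat J Ψ e0 e1) {a w v : R} (ha : a ∈ J) (hae : ‖Ψ a‖ ≤ e1) {p q p' q' : V}
    (h1 : Good J Ψ a w p q) (h2 : Good J Ψ a v p' q') (hp : ‖p‖ ≤ e1) (hp' : ‖p'‖ ≤ e1) 
    (hpp : ‖p + p'‖ ≤ e1) : Good J Ψ a (w + v) (p + p') (q + q') := by
  obtain ⟨a1, rfl, rfl⟩ := h1
  obtain ⟨b1, rfl, rfl⟩ := h2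
  refine ⟨D.mem _ a1 _ b1 ?_, D.add _ a1 _ b1, ?_⟩
  · rw [D.add _ a1 _ b1]; exact hpp.trans D.e10
  · rw [add_mul, D.add _ (D.mul _ a1 _ ha hp hae) _ (D.mul _ b1 _ ha hp' hae)]

lemma good_sum (D : Dat J Ψ e0 e1) {a w : R} (ha : a ∈ J) (hae : ‖Ψ a‖ ≤ e1) {p q : V} {e2 : ℝ}
    (he2 : 0 ≤ e2) {κ : Type*} (s : Finset κ) {v : κ → R} {p' q' : κ → V}
    (h1 : Good J Ψ a w p q) (h2 : ∀ j ∈ s, Good J Ψ a (v j) (p' j) (q' j)) (hp' : ∀ j ∈ s, ‖p' j‖ ≤ e2)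
    (hp : ‖p‖ + s.card * e2 ≤ e1) : 
    Good J Ψ a (w + ∑ j ∈ s, v j) (p + ∑ j ∈ s, p' j) (q + ∑ j ∈ s, q' j) := by
  classical
  induction s using Finset.induction_on with
  | empty => simpa using h1
  | insert j s hj ih =>
    rw [Finset.card_insert_of_notMem hj] at hp
    push_cast at hp
    have i1 := ih (fun i hi => h2 i (Finset.mem_insert_of_mem hi)) 
      (fun i hi => hp' i (Finset.mem_insert_of_mem hi)) (by nlinarith)
    have n1 : ‖∑ i ∈ s, p' i‖ ≤ s.card * e2 := by
      refine (norm_sum_le _ _).trans ?_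
      refine (Finset.sum_le_card_nsmul _ _ e2 (fun i hi => hp' i (Finset.mem_insert_of_mem hi))).trans ?_
      rw [nsmul_eq_mul]
    have n2 := norm_add_le p (∑ i ∈ s, p' i)
    have n3 := hp' j (Finset.mem_insert_self _ _)
    have n4 := norm_add_le (p + ∑ i ∈ s, p' i) (p' j)
    have n5 : 0 ≤ s.card * e2 := by positivity
    have n6 := norm_nonneg p
    have := D.good_add ha hae i1 (h2 j (Finset.mem_insert_self _ _)) (by linarith) (by linarith) (by linarith)
    rw [Finset.sum_insert hj, Finset.sum_insert hj, Finset.sum_insert hj]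
    rw [add_comm (v j), add_comm (p' j), add_comm (q' j), ← add_assoc, ← add_assoc, ← add_assoc]
    exact this

lemma lin1 (D : Dat J Ψ e0 e1) {a : R} (ha : a ∈ J) (hae : ‖Ψ a‖ ≤ e1) {e2 : ℝ}
    (he2 : 0 ≤ e2) {κ : Type*} [Fintype κ] (hκ : 2 * (Fintype.card κ * e2) ≤ e1) (he21 : e2 ≤ e1) {u : κ → R}
    (hu : ∀ j, u j ∈ J) (hue : ∀ j, ‖Ψ (u j)‖ ≤ e2) {t : κ → ℝ} (ht : ∀ j, |t j| ≤ 1) 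
    (hrel : ∑ j, t j • Ψ (u j) = 0) : ∑ j, t j • Ψ (u j * a) = 0 := by
  have frac : ∀ (n : ℕ) (w : κ → V), ‖∑ j, ⌊n * t j⌋ • w j - n • ∑ j, t j • w j‖ ≤ ∑ j, ‖w j‖ := by
    intro n w
    rw [Finset.smul_sum, ← Finset.sum_sub_distrib]
    refine (norm_sum_le _ _).trans (Finset.sum_le_sum fun j _ => ?_)
    have : ⌊n * t j⌋ • w j - n • t j • w j = ((⌊n * t j⌋ : ℝ) - n * t j) • w j := by
      rw [sub_smul, Int.cast_smul_eq_zsmul, mul_smul, Nat.cast_smul_eq_nsmul]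
    rw [this, norm_smul]
    have a1 := Int.floor_le (n * t j)
    have a2 := Int.lt_floor_add_one (n * t j)
    have : ‖(⌊n * t j⌋ : ℝ) - n * t j‖ ≤ 1 := by
      rw [Real.norm_eq_abs, abs_le]; constructor <;> linarith
    have := norm_nonneg (w j)
    nlinarith
  have bd1 : ∀ n : ℕ, ‖∑ j, ⌊n * t j⌋ • Ψ (u j)‖ ≤ Fintype.card κ * e2 := by
    intro n
    have := frac n (fun j => Ψ (u j))
    rw [hrel, smul_zero, sub_zero] at this
    refine this.trans ?_
    refine (Finset.sum_le_card_nsmul _ _ e2 (fun i _ => hue i)).trans ?_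
    rw [nsmul_eq_mul, Finset.card_univ]
  have good : ∀ n : ℕ, Good J Ψ a (∑ j, ⌊n * t j⌋ • u j) (∑ j, ⌊n * t j⌋ • Ψ (u j)) 
      (∑ j, ⌊n * t j⌋ • Ψ (u j * a)) := by
    intro n
    induction n with
    | zero => simp [Good, D.zero, D.map_zero]
    | succ n ih =>
      have hc : ∀ j, -1 ≤ ⌊((n + 1 : ℕ) : ℝ) * t j⌋ - ⌊n * t j⌋ ∧ ⌊((n + 1 : ℕ) : ℝ) * t j⌋ - ⌊n * t j⌋ ≤ 1 := by
        intro j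
        have t1 := abs_le.1 (ht j)
        constructor
        · have : ⌊n * t j⌋ - 1 ≤ ⌊((n + 1 : ℕ) : ℝ) * t j⌋ := by
            rw [Int.le_floor]; push_cast
            have := Int.floor_le (n * t j)
            linarith
          omega
        · have : ⌊((n + 1 : ℕ) : ℝ) * t j⌋ < ⌊n * t j⌋ + 2 := by
            rw [Int.floor_lt]; push_cast
            have := Int.lt_floor_add_one (n * t j)
            linarith
          omega
      have := D.good_sum ha hae he2 Finset.univ ih 
        (v := fun j => (⌊((n + 1 : ℕ) : ℝ) * t j⌋ - ⌊n * t j⌋) • u j)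
        (p' := fun j => (⌊((n + 1 : ℕ) : ℝ) * t j⌋ - ⌊n * t j⌋) • Ψ (u j))
        (q' := fun j => (⌊((n + 1 : ℕ) : ℝ) * t j⌋ - ⌊n * t j⌋) • Ψ (u j * a)) ?_ ?_ ?_
      · simpa only [← Finset.sum_add_distrib, ← add_smul, add_sub_cancel] using this
      · intro j _
        have m1 := D.neg_smul_mem (hu j) (hc j)
        refine ⟨m1.1, m1.2, ?_⟩
        rw [smul_mul_assoc]
        exact (D.neg_smul_mem (D.mul _ (hu j) _ ha ((hue j).trans he21) hae) (hc j)).2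
      · intro j _
        rw [← Int.cast_smul_eq_zsmul ℝ, norm_smul]
        have : ‖((⌊((n + 1 : ℕ) : ℝ) * t j⌋ - ⌊n * t j⌋ : ℤ) : ℝ)‖ ≤ 1 := by
          rw [Real.norm_eq_abs, abs_le]
          exact ⟨by exact_mod_cast (hc j).1, by exact_mod_cast (hc j).2⟩
        have := hue j
        have := norm_nonneg (Ψ (u j))
        nlinarith
      · rw [Finset.card_univ]
        have := bd1 n
        linarith
  have bd2 : ∀ n : ℕ, n * ‖∑ j, t j • Ψ (u j * a)‖ ≤ e0 + ∑ j, ‖Ψ (u j * a)‖ := by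
    intro n
    obtain ⟨g1, g2, g3⟩ := good n
    have b := frac n (fun j => Ψ (u j * a))
    have c : ‖∑ j, ⌊n * t j⌋ • Ψ (u j * a)‖ ≤ e0 := by
      rw [← g3]
      refine D.bd _ (D.mul _ g1 _ ha ?_ hae)
      rw [g2]
      have := bd1 n
      have : 0 ≤ Fintype.card κ * e2 := by positivity
      linarith
    rw [← norm_nat_smul]
    have := norm_le_norm_add_norm_sub (∑ j, ⌊n * t j⌋ • Ψ (u j * a)) (n • ∑ j, t j • Ψ (u j * a))
    linarith
  by_contra hne
  have hp : 0 < ‖∑ j, t j • Ψ (u j * a)‖ := norm_pos_iff.2 hne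
  obtain ⟨n, hn⟩ := exists_nat_gt ((e0 + ∑ j, ‖Ψ (u j * a)‖) / ‖∑ j, t j • Ψ (u j * a)‖)
  rw [div_lt_iff₀ hp] at hn
  linarith [bd2 n]

lemma lin2 (D : Dat J Ψ e0 e1) {a : R} (ha : a ∈ J) (hae : ‖Ψ a‖ ≤ e1) {e2 : ℝ}
    (he2 : 0 ≤ e2) {κ : Type*} [Fintype κ] (hκ : 2 * (Fintype.card κ * e2) ≤ e1) (he21 : e2 ≤ e1) {u : κ → R}
    (hu : ∀ j, u j ∈ J) (hue : ∀ j, ‖Ψ (u j)‖ ≤ e2) {t : κ → ℝ}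
    (hrel : ∑ j, t j • Ψ (u j) = 0) : ∑ j, t j • Ψ (u j * a) = 0 := by
  set c : ℝ := 1 + ∑ j, |t j| with hc
  have hcs : 0 ≤ ∑ j, |t j| := Finset.sum_nonneg fun j _ => abs_nonneg _
  have hcp : 0 < c := by linarith
  have := D.lin1 ha hae he2 hκ he21 hu hue (t := fun j => c⁻¹ * t j) ?_ ?_
  · simp_rw [mul_smul] at this
    rw [← Finset.smul_sum, smul_eq_zero] at this
    exact this.resolve_left (inv_ne_zero hcp.ne')
  · intro j
    rw [abs_mul, abs_inv, abs_of_pos hcp, inv_mul_le_iff₀ hcp, mul_one]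
    have := Finset.single_le_sum (fun i _ => abs_nonneg (t i)) (Finset.mem_univ j)
    linarith
  · simp_rw [mul_smul]
    rw [← Finset.smul_sum, hrel, smul_zero]

end Dat
end Alg

section Alg2
variable {R : Type u} [NonUnitalRing R] {V : Type} [NormedAddCommGroup V] [NormedSpace ℝ V] 

lemma mulIter_anti {S : Set R} (hS : S * S ⊆ S) (m : ℕ) : mulIter S (m + 1) ⊆ mulIter S m := by
  induction m with
  | zero => exact hS
  | succ m ih => exact Set.mul_subset_mul_right ih

lemma mulIter_closure {S : Set R} (hS : S * S ⊆ S) (m : ℕ) : 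
    mulIter (NonUnitalSubring.closure S : Set R) m ⊆ AddSubgroup.closure (mulIter S m) := by
  have hT : (NonUnitalSubring.closure S : Set R) ⊆ AddSubgroup.closure S := by
    intro x hx
    have hx' := NonUnitalSubring.mem_closure_iff.1 hx
    refine (AddSubgroup.closure_le _).2 ?_ hx'
    intro y hy
    apply AddSubgroup.subset_closure
    induction hy using Subsemigroup.closure_induction with
    | mem y hy => exact hy
    | mul a b _ _ ha hb => exact hS (Set.mul_mem_mul ha hb)
  induction m with
  | zero => exact hT
  | succ m ih =>
    rintro _ ⟨x, hx, y, hy, rfl⟩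
    have hx' := ih hx
    have hy' := hT hy
    simp only [SetLike.mem_coe] at hx' hy' ⊢
    clear hx hy
    induction hx' using AddSubgroup.closure_induction with
    | zero => simp
    | add a b _ _ ha hb => rw [add_mul]; exact add_mem ha hb
    | neg a _ ha => rw [neg_mul]; exact neg_mem ha
    | mem a ha =>
      induction hy' using AddSubgroup.closure_induction with
      | zero => simp
      | add c d _ _ hc hd => rw [mul_add]; exact add_mem hc hd
      | neg c _ hc => rw [mul_neg]; exact neg_mem hc
      | mem c hc => exact AddSubgroup.subset_closure (Set.mul_mem_mul ha hc)

theorem Dat.main [FiniteDimensional ℝ V] {J : Set R} {Ψ : R → V} {e0 e1 e2 : ℝ} (D : Dat J Ψ e0 e1) 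
    (hfin : J.Finite) {d L : ℕ} (hd : Module.finrank ℝ V ≤ d) (he2 : 0 < e2) (hL : 4 * e0 ≤ L * e1) 
    (hL2 : L * e2 ≤ e1) (hde : 2 * ((d + 1) * e2) ≤ e1) {J2 I : Set R} (hJ2 : J2 = {y | y ∈ J ∧ ‖Ψ y‖ ≤ e2})
    (hI : I = {y | y ∈ J ∧ Ψ y = 0}) : 
    IsTwoSidedIdealIn I (NonUnitalSubring.closure J2 : Set R) ∧ I ⊆ J2 ∧ 
    mulIter (NonUnitalSubring.closure J2 : Set R) d ⊆ I := by
  have e1p := D.e1pos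
  have e10 := D.e10
  have he21 : e2 ≤ e1 := by
    have : 0 ≤ (d : ℝ) * e2 := by positivity
    linarith
  have mL : ∀ a ∈ J2, ∀ y ∈ J, ‖Ψ y‖ ≤ e1 → a * y ∈ J ∧ ‖Ψ (a * y)‖ ≤ 1 / 2 * ‖Ψ y‖ := by
    intro a ha y hy hye
    rw [hJ2] at ha
    have : (L : ℝ) * ‖Ψ a‖ ≤ e1 := le_trans (mul_le_mul_of_nonneg_left ha.2 (by positivity)) hL2
    exact D.contr AddMonoidHom.mul D.mul hL ha.1 hy this hye
  have mR : ∀ a ∈ J2, ∀ y ∈ J, ‖Ψ y‖ ≤ e1 → y * a ∈ J ∧ ‖Ψ (y * a)‖ ≤ 1 / 2 * ‖Ψ y‖ := by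
    intro a ha y hy hye
    rw [hJ2] at ha
    have : (L : ℝ) * ‖Ψ a‖ ≤ e1 := le_trans (mul_le_mul_of_nonneg_left ha.2 (by positivity)) hL2
    exact D.contr AddMonoidHom.mul.flip (fun a ha b hb h1 h2 => D.mul b hb a ha h2 h1) hL ha.1 hy this hye
  have hmul : J2 * J2 ⊆ J2 := by
    rintro _ ⟨a, ha, b, hb, rfl⟩
    have hb' := hb
    rw [hJ2] at hb'
    obtain ⟨h1, h2⟩ := mL a ha b hb'.1 (hb'.2.trans he21)
    rw [hJ2]
    refine ⟨h1, ?_⟩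
    have := hb'.2
    simp only
    linarith
  have hIJ : I ⊆ J2 := by
    intro y hy
    rw [hI] at hy
    rw [hJ2]
    exact ⟨hy.1, by rw [hy.2, norm_zero]; exact he2.le⟩
  have I0 : (0 : R) ∈ I := by rw [hI]; exact ⟨D.zero, D.map_zero⟩
  have Iadd : ∀ x ∈ I, ∀ y ∈ I, x + y ∈ I := by
    intro x hx y hy
    rw [hI] at hx hy ⊢
    have : Ψ (x + y) = 0 := by rw [D.add _ hx.1 _ hy.1, hx.2, hy.2, add_zero]
    exact ⟨D.mem _ hx.1 _ hy.1 (by rw [this, norm_zero]; linarith), this⟩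
  have Ineg : ∀ x ∈ I, -x ∈ I := by
    intro x hx
    rw [hI] at hx ⊢
    exact ⟨D.neg _ hx.1, by rw [D.map_neg hx.1, hx.2, neg_zero]⟩
  have Iid : ∀ r ∈ (NonUnitalSubring.closure J2 : Set R), ∀ x ∈ I, r * x ∈ I ∧ x * r ∈ I := by
    intro r hr
    have hr' : r ∈ NonUnitalSubring.closure J2 := hr
    induction hr' using NonUnitalSubring.closure_induction with
    | mem a ha =>
      intro x hx
      rw [hI] at hx
      have z : ‖Ψ x‖ ≤ e1 := by rw [hx.2, norm_zero]; exact e1p.le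
      have l := mL a ha x hx.1 z
      have r := mR a ha x hx.1 z
      rw [hx.2, norm_zero, mul_zero, norm_le_zero_iff] at l r
      rw [hI]
      exact ⟨l, r⟩
    | zero => intro x _; simp [I0]
    | add a b ha' hb' ha hb =>
      intro x hx
      rw [add_mul, mul_add]
      exact ⟨Iadd _ (ha ha' x hx).1 _ (hb hb' x hx).1, Iadd _ (ha ha' x hx).2 _ (hb hb' x hx).2⟩
    | neg a ha' ha =>
      intro x hx
      rw [neg_mul, mul_neg]
      exact ⟨Ineg _ (ha ha' x hx).1, Ineg _ (ha ha' x hx).2⟩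
    | mul a b ha' hb' ha hb =>
      intro x hx
      rw [mul_assoc, ← mul_assoc x]
      exact ⟨(ha ha' _ (hb hb' x hx).1).1, (hb hb' _ (ha ha' x hx).2).2⟩
  refine ⟨⟨fun x hx => NonUnitalSubring.subset_closure (hIJ hx), I0, Iadd, Ineg, Iid⟩, hIJ, ?_⟩
  -- nilpotency
  set P : ℕ → Set R := mulIter J2 with hP
  have Pm : ∀ m, P m ⊆ J2 := by
    intro m
    induction m with
    | zero => exact subset_rfl
    | succ m ih => exact (mulIter_anti hmul m).trans ih
  set W : ℕ → Submodule ℝ V := fun m => Submodule.span ℝ (Ψ '' P m) with hW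
  have Wanti : ∀ m, W (m + 1) ≤ W m := fun m => 
    Submodule.span_mono (Set.image_mono (mulIter_anti hmul m))
  have stab : ∀ m, W (m + 1) = W m → W (m + 2) = W (m + 1) := by
    intro m hm
    refine le_antisymm (Wanti _) ?_
    refine Submodule.span_le.2 ?_
    rintro _ ⟨_, ⟨p, hp, a, ha, rfl⟩, rfl⟩
    have h1 : Ψ p ∈ W (m + 1) := by
      rw [hm]; exact Submodule.subset_span ⟨p, hp, rfl⟩
    have hnd : Module.finrank ℝ (Submodule.span ℝ (Ψ '' P (m + 1))) ≤ d := (Submodule.finrank_le _).trans hd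
    obtain ⟨f, hf1, hf2, hf3⟩ := Submodule.exists_fun_fin_finrank_span_eq ℝ (Ψ '' P (m + 1))
    generalize Module.finrank ℝ (Submodule.span ℝ (Ψ '' P (m + 1))) = n at *
    choose u hu huf using hf1
    rw [hW] at h1
    simp only at h1
    rw [← hf2, Submodule.mem_span_range_iff_exists_fun] at h1
    obtain ⟨c, hc⟩ := h1
    have haJ : a ∈ J ∧ ‖Ψ a‖ ≤ e2 := by rw [hJ2] at ha; exact ha
    have hpJ : p ∈ J ∧ ‖Ψ p‖ ≤ e2 := by have := Pm _ hp; rw [hJ2] at this; exact this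
    have huJ : ∀ i, u i ∈ J ∧ ‖Ψ (u i)‖ ≤ e2 := by 
      intro i; have := Pm _ (hu i); rw [hJ2] at this; exact this
    have := D.lin2 haJ.1 (haJ.2.trans he21) he2.le (κ := Option (Fin n)) (by
        rw [Fintype.card_option, Fintype.card_fin]
        have : ((n + 1 : ℕ) : ℝ) ≤ d + 1 := by exact_mod_cast Nat.succ_le_succ hnd
        have := mul_le_mul_of_nonneg_right this he2.le
        linarith) he21 
      (u := fun o => o.elim p u) (by rintro (_ | i); exacts [hpJ.1, (huJ i).1])
      (by rintro (_ | i); exacts [hpJ.2, (huJ i).2]) (t := fun o => o.elim (-1) c) (by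
        rw [Fintype.sum_option]
        simp only [Option.elim, huf]
        rw [hc]; simp)
    rw [Fintype.sum_option] at this
    simp only [Option.elim, neg_smul, one_smul] at this
    have h2 : Ψ (p * a) = ∑ i, c i • Ψ (u i * a) := by
      rw [neg_add_eq_zero] at this; exact this
    simp only
    rw [h2]
    refine Submodule.sum_mem _ fun i _ => Submodule.smul_mem _ _ (Submodule.subset_span ?_)
    exact ⟨_, Set.mul_mem_mul (hu i) ha, rfl⟩
  have Pn : ∀ m, ∀ p ∈ P m, ‖Ψ p‖ ≤ (1 / 2) ^ m * e2 := by
    intro m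
    induction m with
    | zero => intro p hp; have := Pm 0 hp; rw [hJ2] at this; simpa using this.2
    | succ m ih =>
      rintro _ ⟨p, hp, a, ha, rfl⟩
      have h1 := ih p hp
      have hpJ : p ∈ J ∧ ‖Ψ p‖ ≤ e2 := by have := Pm _ hp; rw [hJ2] at this; exact this
      have h2 := (mR a ha p hpJ.1 (hpJ.2.trans he21)).2
      simp only
      rw [pow_succ]
      linarith
  have ev0 : ∃ m, W m = ⊥ := by
    obtain ⟨c, hc0, hc⟩ : ∃ c > 0, ∀ y ∈ J, ‖Ψ y‖ < c → Ψ y = 0 := by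
      have hf : ((fun y => ‖Ψ y‖) '' J \ {0}).Finite := (hfin.image _).sdiff
      rcases Set.eq_empty_or_nonempty ((fun y => ‖Ψ y‖) '' J \ {0}) with h | h
      · refine ⟨1, one_pos, fun y hy _ => ?_⟩
        by_contra hne
        have : ‖Ψ y‖ ∈ ((fun y => ‖Ψ y‖) '' J \ {0}) := ⟨⟨y, hy, rfl⟩, by simpa using hne⟩
        rw [h] at this; exact this
      · obtain ⟨c, hc1, hc2⟩ := Set.exists_min_image _ id hf h
        obtain ⟨⟨y0, hy0, rfl⟩, hne⟩ := hc1
        refine ⟨‖Ψ y0‖, lt_of_le_of_ne (norm_nonneg _) (fun h => hne (by simpa using h.symm)), ?_⟩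
        intro y hy hlt
        by_contra hne
        have := hc2 ‖Ψ y‖ ⟨⟨y, hy, rfl⟩, by simpa using hne⟩
        simp only [id] at this
        linarith
    obtain ⟨m, hm⟩ := exists_pow_lt_of_lt_one (show 0 < c / e2 by positivity) (show (1 / 2 : ℝ) < 1 by norm_num)
    rw [lt_div_iff₀ he2] at hm
    refine ⟨m, ?_⟩
    rw [hW]
    simp only
    rw [Submodule.span_eq_bot]
    rintro _ ⟨p, hp, rfl⟩
    have hpJ := Pm _ hp
    rw [hJ2] at hpJ
    exact hc p hpJ.1 ((Pn m p hp).trans_lt hm)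
  have const : ∀ m, W (m + 1) = W m → ∀ k, W (m + k + 1) = W (m + k) := by
    intro m hm k
    induction k with
    | zero => exact hm
    | succ k ih => exact stab _ ih
  have const2 : ∀ m, W (m + 1) = W m → ∀ k, W (m + k) = W m := by
    intro m hm k
    induction k with
    | zero => rfl
    | succ k ih => rw [← ih]; exact const m hm k
  have Wanti' : Antitone W := antitone_nat_of_succ_le Wanti
  have drop : ∀ m, W m = ⊥ ∨ Module.finrank ℝ (W m) + m ≤ d := by
    intro m
    induction m with
    | zero => right; exact (Submodule.finrank_le _).trans hd
    | succ m ih =>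
      rcases ih with h | h
      · left; exact le_bot_iff.1 (h ▸ Wanti m)
      · by_cases he : W (m + 1) = W m
        · left
          obtain ⟨k, hk⟩ := ev0
          have a := const2 m he k
          rw [he, ← a]
          exact le_bot_iff.1 (hk ▸ Wanti' (by omega))
        · right
          have := Submodule.finrank_lt_finrank_of_lt (lt_of_le_of_ne (Wanti m) he)
          omega
  have Wd : W d = ⊥ := by
    rcases drop d with h | h
    · exact h
    · exact Submodule.finrank_eq_zero.1 (by omega)
  have PI : P d ⊆ I := by
    intro p hp
    have hpJ := Pm _ hp
    rw [hJ2] at hpJ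
    rw [hI]
    refine ⟨hpJ.1, ?_⟩
    have : Ψ p ∈ W d := Submodule.subset_span ⟨p, hp, rfl⟩
    rw [Wd] at this
    simpa using this
  refine (mulIter_closure hmul d).trans ?_
  intro x hx
  have hx' : x ∈ AddSubgroup.closure (P d) := hx
  induction hx' using AddSubgroup.closure_induction with
  | mem y hy => exact PI hy
  | zero => exact I0
  | add a b ha' hb' ha hb => exact Iadd _ (ha ha') _ (hb hb')
  | neg a ha' ha => exact Ineg _ (ha ha')
end Alg2

noncomputable section Net

lemma norm_triple {a b c a' b' c' : ℂ} (ha : ‖a‖ = 1)  (hb' : ‖b'‖ = 1) (hc : ‖c‖ = 1) {ε : ℝ}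
    (h1 : ‖b - b'‖ ≤ ε) (h2 : ‖c - c'‖ ≤ ε) (haa : a = a') : 
    ‖a * b * star c - a' * b' * star c'‖ ≤ 2 * ε := by
  subst haa
  have e : a * b * star c - a * b' * star c' = a * ((b - b') * star c + b' * star (c - c')) := by
    rw [star_sub]; ring
  rw [e, norm_mul, ha, one_mul]
  refine (norm_add_le _ _).trans ?_
  rw [norm_mul, norm_mul, norm_star, norm_star, hc, hb']
  linarith

lemma pair_col (K M : ℕ) (δ ε : ℝ) (hδ : 0 < δ) (hε : 0 < ε) : ∃ n : ℕ, 
    ∀ (R : Type u) [NonUnitalRing R] [DecidableEq R] (X F : Finset R) (Z : Set R), (0 : R) ∈ X → 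
    X + X ⊆ F + X → F.card ≤ K → Cov M Z (X : Set R) → ∀ γ ∈ Gs X δ, 
    Col (fun a : Z => lmul γ (a : R)) (X : Set R) n (2 * ε) := by
  obtain ⟨m, hm⟩ := spec_col.{u} K δ ε hδ hε
  refine ⟨M * ⌊(K : ℝ) / δ⌋₊ * (m * m), ?_⟩
  intro R _ _ X F Z h0 hF hFK hZ γ hγ
  obtain ⟨c, hc⟩ := hm R X F h0 hF hFK
  have hXpos : 0 < (X.card : ℝ) := by exact_mod_cast Finset.card_pos.2 ⟨0, h0⟩
  have hApos : 0 < ((Ac X δ γ).card : ℝ) := lt_of_lt_of_le (mul_pos hδ hXpos) hγ.2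
  have hAX : Ac X δ γ ⊆ X := by
    classical
    intro x hx; unfold Ac at hx; exact (Finset.mem_filter.1 hx).1
  have hAS : ∀ x ∈ Ac X δ γ, lmul γ x ∈ Sp X δ := by
    classical
    intro x hx; unfold Ac at hx; exact (Finset.mem_filter.1 hx).2
  obtain ⟨F', hF'X, hF'c, hF'⟩ := Finset.ruzsa_covering_add (A := X) (B := Ac X δ γ) (K := (K : ℝ) / δ) 
    (Finset.card_pos.1 (by exact_mod_cast hApos)) (by
      have h1 : (X + Ac X δ γ).card ≤ K * X.card := 
        (Finset.card_le_card ((Finset.add_subset_add_left hAX).trans hF)).trans 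
          (Finset.card_add_le.trans (Nat.mul_le_mul_right _ hFK))
      have h2 : ((X + Ac X δ γ).card : ℝ) ≤ K * X.card := by exact_mod_cast h1
      have h3 : (X.card : ℝ) ≤ (Ac X δ γ).card / δ := by rw [le_div_iff₀ hδ]; linarith [hγ.2]
      calc _ ≤ (K : ℝ) * X.card := h2
        _ ≤ K * ((Ac X δ γ).card / δ) := by gcongr
        _ = _ := by ring)
  obtain ⟨E, hE, hZE⟩ := hZ
  have hrep : ∀ a : Z, ∃ e : (E + F' : Finset R), ∃ a1 : (Ac X δ γ), ∃ a2 : (Ac X δ γ), 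
      (a : R) = e + a1 - a2 := by
    intro a
    obtain ⟨e, he, x, hx, hex⟩ := hZE a.2
    obtain ⟨f, hf, d, hd, hfd⟩ := Finset.mem_add.1 (hF' hx)
    obtain ⟨a1, h1, a2, h2, h12⟩ := Finset.mem_sub.1 hd
    refine ⟨⟨e + f, Finset.add_mem_add he hf⟩, ⟨a1, h1⟩, ⟨a2, h2⟩, ?_⟩
    simp only at hex ⊢
    rw [← hex, ← hfd, ← h12]; abel
  choose e a1 a2 hr using hrep
  refine Col.of_fintype (κ := (E + F' : Finset R) × (Fin m × Fin m)) ?_ 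
    (fun a => (e a, c ⟨lmul γ (a1 a), hAS _ (a1 a).2⟩, c ⟨lmul γ (a2 a), hAS _ (a2 a).2⟩)) ?_
  · simp only [Fintype.card_prod, Fintype.card_coe, Fintype.card_fin]
    refine Nat.mul_le_mul_right _ (Finset.card_add_le.trans (Nat.mul_le_mul hE ?_))
    exact Nat.le_floor hF'c
  · intro i j hij x hx
    simp only [Prod.mk.injEq] at hij
    obtain ⟨h1, h2, h3⟩ := hij
    have b1 := hc _ _ h2 x hx
    have b2 := hc _ _ h3 x hx
    simp only [ev_lmul] at b1 b2 ⊢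
    rw [hr i, hr j]
    simp only [add_mul, sub_mul, ev_add, ev_sub]
    exact norm_triple (norm_ev _ _) (norm_ev _ _) (norm_ev _ _) b1 b2 (by rw [h1])

/-- the family of characters used -/
def fam {R : Type u} [NonUnitalRing R] (X : Finset R) (δ : ℝ) (Z : Set R) : 
    (Gs X δ ⊕ (Gs X δ × Z)) → Dl R := 
  Sum.elim (fun γ => γ.1) (fun p => lmul p.1.1 p.2.1)

lemma net (K M MQ : ℕ) (δ : ℝ) (hδ : 0 < δ) : ∃ n : ℕ, 
    ∀ (R : Type u) [NonUnitalRing R] [DecidableEq R] (X F : Finset R) (Z Q : Set R), (0 : R) ∈ X → 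
    X + X ⊆ F + X → F.card ≤ K → Cov M Z (X : Set R) → Cov MQ Q (X : Set R) → 
    (∀ a ∈ Z, ∀ x ∈ X, a * x ∈ Q) → 
    Col (fam X δ Z) Q n (1 / 20) := by
  obtain ⟨m, hm⟩ := spec_col.{u} K δ (1 / 320) hδ (by norm_num)
  obtain ⟨n1, hn1⟩ := Col.extend.{u} m MQ (1 / 320) (by norm_num)
  obtain ⟨n2, hn2⟩ := pair_col.{u} K M δ (1 / 320) hδ (by norm_num)
  obtain ⟨n3, hn3⟩ := Col.extend.{u} (n1 * n2) MQ (1 / 40) (by norm_num)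
  refine ⟨n1 + n3, ?_⟩
  intro R _ _ X F Z Q h0 hF hFK hZ hQ hZX
  obtain ⟨E, hE, hQE⟩ := hQ
  have hG : Col (fun γ : Gs X δ => (γ : Dl R)) Q n1 (2 * (1 / 320)) := by
    refine hn1 R (Gs X δ) _ (X : Set R) Q E hE hQE ?_
    obtain ⟨c, hc⟩ := hm R X F h0 hF hFK
    exact ⟨fun γ => c ⟨γ.1, γ.2.1⟩, fun i j hij => hc _ _ hij⟩
  obtain ⟨c, hc⟩ := hG
  have hP : Col (fun p : Gs X δ × Z => lmul p.1.1 p.2.1) Q n3 (2 * (1 / 40)) := by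
    refine hn3 R (Gs X δ × Z) _ (X : Set R) Q E hE hQE ?_
    have hr : ∀ γ : Gs X δ, ∃ f : Z → Fin n2, ∀ i j, f i = f j → ∀ x ∈ (X : Set R), 
        ‖ev (lmul γ.1 (i : R)) x - ev (lmul γ.1 (j : R)) x‖ ≤ 2 * (1 / 320) := 
      fun γ => hn2 R X F Z h0 hF hFK hZ γ γ.2
    choose f hf using hr
    have hrep : ∀ k : Set.range c, c k.2.choose = k := fun k => k.2.choose_spec
    let r : Gs X δ → Gs X δ := fun γ => (⟨c γ, γ, rfl⟩ : Set.range c).2.choose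
    have hr1 : ∀ γ, c (r γ) = c γ := fun γ => hrep ⟨c γ, γ, rfl⟩
    have hr2 : ∀ γ γ', c γ = c γ' → r γ = r γ' := by
      intro γ γ' h
      simp only [r, h]
    refine Col.of_fintype (κ := Fin n1 × Fin n2) (by simp) (fun p => (c p.1, f (r p.1) p.2)) ?_
    intro p p' hpp x hx
    simp only [Prod.mk.injEq] at hpp
    obtain ⟨h1, h2⟩ := hpp
    rw [← hr2 _ _ h1] at h2
    have b1 := hc _ _ (hr1 p.1) (p.2.1 * x) (hZX _ p.2.2 _ hx)
    have b2 := hc _ _ ((hr1 p.1).trans h1) (p'.2.1 * x) (hZX _ p'.2.2 _ hx)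
    have b3 := hf _ _ _ h2 x hx
    simp only [ev_lmul] at b3 ⊢
    rw [norm_sub_rev] at b1
    have t1 := norm_sub_le_norm_sub_add_norm_sub (ev p.1.1 (p.2.1 * x)) (ev (r p.1).1 (p.2.1 * x)) (ev p'.1.1 (p'.2.1 * x))
    have t2 := norm_sub_le_norm_sub_add_norm_sub (ev (r p.1).1 (p.2.1 * x)) (ev (r p.1).1 (p'.2.1 * x)) (ev p'.1.1 (p'.2.1 * x))
    linarith
  obtain ⟨c', hc'⟩ := hP
  refine Col.of_fintype (κ := Fin n1 ⊕ Fin n3) (by simp) (Sum.map c c') ?_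
  rintro (i | i) (j | j) hij x hx <;> simp at hij
  · have := hc _ _ hij x hx
    simp only [fam, Sum.elim_inl]; linarith
  · have := hc' _ _ hij x hx
    simp only [fam, Sum.elim_inr]; linarith

end Net

noncomputable section Build

lemma norm_sub_one_le {z : ℂ} (hz : ‖z‖ = 1) : ‖z - 1‖ ≤ |z.arg| := by
  have h0 : z ≠ 0 := by intro h; rw [h] at hz; simp at hz
  rw [← Complex.angle_one_right h0]
  exact Complex.norm_sub_le_angle hz (by simp)

lemma abs_arg_le {z : ℂ} (hz : ‖z‖ = 1) : |z.arg| ≤ 2 * ‖z - 1‖ := by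
  have h0 : z ≠ 0 := by intro h; rw [h] at hz; simp at hz
  rw [← Complex.angle_one_right h0]
  refine (Complex.angle_le_mul_norm_sub hz (by simp)).trans ?_
  have := Real.pi_le_four
  gcongr
  linarith

variable {R : Type u} [NonUnitalRing R]

/-- the coordinates of an element -/
def Psi {κ : Type} (θ : κ → Dl R) (y : R) : κ → ℝ := fun k => (ev (θ k) y).arg

/-- the set `J` -/
def JJ {κ : Type} [Fintype κ] (Q : Set R) (θ : κ → Dl R) : Set R := {y | y ∈ Q ∧ ‖Psi θ y‖ ≤ 1 / 4}

lemma Psi_le {κ : Type} [Fintype κ] {θ : κ → Dl R} {y : R} {e : ℝ} (he : 0 ≤ e) : 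
    ‖Psi θ y‖ ≤ e ↔ ∀ k, |(ev (θ k) y).arg| ≤ e := by
  rw [pi_norm_le_iff_of_nonneg he]; rfl

lemma near_one {κ ι : Type*} {f : ι → Dl R} {θ : κ → Dl R} {Q : Set R} 
    (h : ∀ i, ∃ k, ∀ x ∈ Q, ‖ev (f i) x - ev (θ k) x‖ ≤ 1 / 20) {y : R} (hy : y ∈ Q) {e : ℝ} 
    (hye : ∀ k, |(ev (θ k) y).arg| ≤ e) (i : ι) : ‖ev (f i) y - 1‖ ≤ e + 1 / 20 := by
  obtain ⟨k, hk⟩ := h i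
  have a := hk y hy
  have b := (norm_sub_one_le (norm_ev (θ k) y)).trans (hye k)
  have := norm_sub_le_norm_sub_add_norm_sub (ev (f i) y) (ev (θ k) y) 1
  linarith

lemma JJ_sub {κ : Type} [Fintype κ] {X : Finset R} {δ : ℝ} {Z Q : Set R} {θ : κ → Dl R}
    (h : ∀ i, ∃ k, ∀ x ∈ Q, ‖ev (fam X δ Z i) x - ev (θ k) x‖ ≤ 1 / 20)
    (hb : ∀ y, (∀ γ ∈ Gs X δ, ‖ev γ y - 1‖ ≤ 1 / 2) → y ∈ Z) : JJ Q θ ⊆ Z := by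
  rintro y ⟨hy, hy2⟩
  rw [Psi_le (by norm_num)] at hy2
  refine hb y fun γ hγ => ?_
  have := near_one h hy hy2 (Sum.inl ⟨γ, hγ⟩)
  simp only [fam, Sum.elim_inl] at this
  linarith

lemma JJ_dat {κ : Type} [Fintype κ] {X : Finset R} {δ : ℝ} {Z Q : Set R} {θ : κ → Dl R}
    (h : ∀ i, ∃ k, ∀ x ∈ Q, ‖ev (fam X δ Z i) x - ev (θ k) x‖ ≤ 1 / 20)
    (hθ : ∀ k, ∃ i, θ k = fam X δ Z i)
    (hb : ∀ y, (∀ γ ∈ Gs X δ, ‖ev γ y - 1‖ ≤ 1 / 2) → y ∈ Z)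
    (hQ0 : (0 : R) ∈ Q) (hQn : ∀ x ∈ Q, -x ∈ Q) (hadd : ∀ x ∈ Z, ∀ y ∈ Z, x + y ∈ Q) 
    (hmul : ∀ x ∈ Z, ∀ y ∈ Z, x * y ∈ Q) : 
    Dat (JJ Q θ) (Psi θ) (1 / 4) (1 / 20) := by
  have hJZ := JJ_sub h hb
  refine ⟨by norm_num, by norm_num, ⟨hQ0, ?_⟩, ?_, fun y hy => hy.2, ?_, ?_, ?_⟩
  · rw [Psi_le (by norm_num)]; intro k; rw [ev_zero]; simp
  · rintro y ⟨hy, hy2⟩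
    refine ⟨hQn y hy, ?_⟩
    rw [Psi_le (by norm_num)] at hy2 ⊢
    intro k
    have : |(ev (θ k) (-y)).arg| = |(ev (θ k) y).arg| := by
      rw [ev_neg]
      have := Complex.arg_conj (ev (θ k) y)
      rw [starRingEnd_apply] at this
      rw [this]
      split_ifs with hh
      · rw [hh]
      · rw [abs_neg]
    rw [this]; exact hy2 k
  · rintro y ⟨hy, hy2⟩ z ⟨hz, hz2⟩
    rw [Psi_le (by norm_num)] at hy2 hz2
    funext k
    have a := abs_le.1 (hy2 k)
    have b := abs_le.1 (hz2 k)
    have := Real.pi_gt_three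
    simp only [Psi, Pi.add_apply, ev_add]
    exact Complex.arg_mul (ev_ne _ _) (ev_ne _ _) ⟨by linarith, by linarith⟩
  · intro y hy z hz hyz
    exact ⟨hadd y (hJZ hy) z (hJZ hz), hyz⟩
  · intro a ha b hb' ha1 hb1
    have haZ := hJZ ha
    have hbZ := hJZ hb'
    refine ⟨hmul a haZ b hbZ, ?_⟩
    rw [Psi_le (by norm_num)] at ha1 hb1 ⊢
    have na := near_one h ha.1 ha1
    have nb := near_one h hb'.1 hb1
    intro k
    refine (abs_arg_le (norm_ev _ _)).trans ?_
    suffices hs : ‖ev (θ k) (a * b) - 1‖ ≤ 1 / 20 + 1 / 20 by linarith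
    obtain ⟨i, hi⟩ := hθ k
    rw [hi]
    rcases i with γ | ⟨γ, c⟩
    · exact nb (Sum.inr (γ, ⟨a, haZ⟩))
    · have hca : (c : R) * a ∈ Z := by
        refine hb _ fun γ' hγ' => ?_
        have := na (Sum.inr (⟨γ', hγ'⟩, c))
        simp only [fam, Sum.elim_inr, ev_lmul] at this
        linarith
      have := nb (Sum.inr (γ, ⟨c * a, hca⟩))
      simp only [fam, Sum.elim_inr, ev_lmul, mul_assoc] at this ⊢
      exact this

lemma JJ_cov (d : ℕ) (e : ℝ) (he : 0 < e) (he4 : e ≤ 1 / 4) : ∃ N : ℕ, ∀ (R : Type u) [NonUnitalRing R] (κ : Type) [Fintype κ] 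
    (_ : Fintype.card κ ≤ d) (θ : κ → Dl R) (X Q : Set R) (_ : ∀ x ∈ X, ∀ y ∈ X, x - y ∈ Q), 
    Cov N X {y | y ∈ JJ Q θ ∧ ‖Psi θ y‖ ≤ e} := by
  obtain ⟨q0, hq0, q, hq⟩ := circle_col (e / 2) (by linarith)
  refine ⟨q0 ^ d, ?_⟩
  intro R _ κ _ hκ θ X Q hQ
  classical
  let col : R → (κ → Fin q0) := fun x k => q (ev (θ k) x)
  let rep : (κ → Fin q0) → R := fun c => if hc : ∃ x ∈ X, col x = c then hc.choose else 0
  have hrep : ∀ x ∈ X, rep (col x) ∈ X ∧ col (rep (col x)) = col x := by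
    intro x hx
    have hc : ∃ x' ∈ X, col x' = col x := ⟨x, hx, rfl⟩
    simp only [rep, dif_pos hc]
    exact hc.choose_spec
  refine ⟨Finset.univ.image rep, ?_, ?_⟩
  · refine Finset.card_image_le.trans ?_
    simp
    exact Nat.pow_le_pow_right hq0 hκ
  · intro x hx
    obtain ⟨h1, h2⟩ := hrep x hx
    refine ⟨rep (col x), by simp, x - rep (col x), ?_, by simp⟩
    have hn : ‖Psi θ (x - rep (col x))‖ ≤ e := by
      rw [Psi_le he.le]
      intro k
      refine (abs_arg_le (norm_ev _ _)).trans ?_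
      have b := hq _ _ (norm_ev _ _) (norm_ev _ _) (congrFun h2 k)
      have : ev (θ k) (x - rep (col x)) - 1 = (ev (θ k) x - ev (θ k) (rep (col x))) * star (ev (θ k) (rep (col x))) := by
        rw [ev_sub, sub_mul]
        congr 1
        rw [← ev_sub, sub_self, ev_zero]
      rw [this, norm_mul, norm_star, norm_ev, mul_one, norm_sub_rev]
      linarith
    exact ⟨⟨hQ _ hx _ h1, hn.trans he4⟩, hn⟩

end Build

theorem stmt1 (K : ℕ) (hK : 1 ≤ K) :
    ∃ N₂ N₄ : ℕ, ∀ (R : Type u) [NonUnitalRing R] (X : Set R),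
      X.Finite → IsApproxSubringWith K X →
      ∃ Y : Set R,
        Y ⊆ (X + X + X + X) + X * (X + X + X + X) ∧ Y.Finite ∧
        IsApproxSubringWith (K ^ 510 + K ^ 22) Y ∧
        NCommensurable N₂ Y X ∧
        ∃ I : Set R, IsTwoSidedIdealIn I (NonUnitalSubring.closure Y : Set R) ∧
          I ⊆ Y ∧
          mulIter (NonUnitalSubring.closure Y : Set R) N₄ ⊆ I := by
  set M : ℕ := K ^ 4 * (K ^ 6 * K) with hM
  have hM1 : (1 : ℝ) ≤ M := by
    have : 1 ≤ M := by
      rw [hM, ← pow_succ, ← pow_add]; exact Nat.one_le_pow _ _ hK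
    exact_mod_cast this
  set MQ : ℕ := (K ^ 22 + K ^ 510) * K with hMQ
  set δ : ℝ := 1 / (12 * M) with hδ
  obtain ⟨d, hd⟩ := net.{u} K M MQ δ (by positivity)
  set e2 : ℝ := 1 / (400 * (d + 1)) with he2
  have hd0 : (0 : ℝ) < d + 1 := by positivity
  have hd1 : (1 : ℝ) ≤ d + 1 := by linarith [(Nat.cast_nonneg d : (0 : ℝ) ≤ d)]
  have e2pos : 0 < e2 := by positivity
  have e2d : (d + 1) * e2 = 1 / 400 := by rw [he2]; field_simp
  have e2le : e2 ≤ 1 / 400 := by rw [← e2d]; nlinarith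
  obtain ⟨N, hN⟩ := JJ_cov.{u} d e2 e2pos (by linarith)
  refine ⟨max M N, d, ?_⟩
  intro R _ X hXf hX
  classical
  obtain ⟨⟨h0, hsym⟩, F, hFK, hF⟩ := hX
  have hneg : ∀ x ∈ X, -x ∈ X := by
    intro x hx; rw [hsym] at hx; exact hx
  have hm : Cov K (X * X) X := ⟨F, hFK, Set.subset_union_left.trans hF⟩
  have ha : Cov K (X + X) X := ⟨F, hFK, Set.subset_union_right.trans hF⟩
  have h2X : Cov K (sS X 2) X := by rw [sS_two]; exact ha
  have hZX : Cov M (ZZ X) X := (cov_ZZ hm).trans ((cov_reduce ha 6).trans h2X)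
  have c2Z := cov_2ZZ ha hm
  have cZZ := cov_ZZZZ hK hneg ha hm
  set Z := ZZ X with hZ
  have h4Z : sS X 4 ⊆ Z := sS4_sub_ZZ h0
  have hZ0 : (0 : R) ∈ Z := h4Z (sS_mono h0 (Nat.zero_le 4) (by simp [sS]))
  have hZneg : ∀ x ∈ Z, -x ∈ Z := ZZ_neg hneg
  have hXZ : X ⊆ Z := by
    intro x hx; exact h4Z (sS_mono h0 (show 1 ≤ 4 by norm_num) (by rwa [sS_one]))
  have hZf : Z.Finite := by
    have : (X + X + X + X).Finite := ((hXf.add hXf).add hXf).add hXf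
    exact this.add (hXf.mul this)
  set Q : Set R := (Z + Z) ∪ (Z * Z) with hQ
  have hQf : Q.Finite := (hZf.add hZf).union (hZf.mul hZf)
  have hQX : Cov MQ Q X := (c2Z.union cZZ).trans h2X
  have hZQ : Z ⊆ Q := fun z hz => Or.inl ⟨z, hz, 0, hZ0, add_zero z⟩
  have hQn : ∀ x ∈ Q, -x ∈ Q := by
    rintro _ (⟨a, ha, b, hb, rfl⟩ | ⟨a, ha, b, hb, rfl⟩)
    · exact Or.inl ⟨-a, hZneg a ha, -b, hZneg b hb, by simp; abel⟩
    · exact Or.inr ⟨-a, hZneg a ha, b, hb, by simp⟩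
  set Xf : Finset R := hXf.toFinset with hXfd
  have cX : (Xf : Set R) = X := hXf.coe_toFinset
  have mX : ∀ x, x ∈ Xf ↔ x ∈ X := fun x => hXf.mem_toFinset
  have hXF : Xf + Xf ⊆ F + Xf := by
    rw [← Finset.coe_subset, Finset.coe_add, Finset.coe_add, cX]
    exact Set.subset_union_right.trans hF
  obtain ⟨c, hc⟩ := hd R Xf F Z Q ((mX 0).2 h0) hXF hFK (by rwa [cX]) (by rwa [cX]) 
    (fun a ha x hx => Or.inr ⟨a, ha, x, hXZ ((mX x).1 hx), rfl⟩)
  -- representatives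
  let κ : Type := {k : Fin d // k ∈ Set.range c}
  have hκ : Fintype.card κ ≤ d := (Fintype.card_subtype_le _).trans (by simp)
  let θ : κ → Dl R := fun k => fam Xf δ Z k.2.choose
  have hθ1 : ∀ i, ∃ k, ∀ x ∈ Q, ‖ev (fam Xf δ Z i) x - ev (θ k) x‖ ≤ 1 / 20 := by
    intro i
    refine ⟨⟨c i, i, rfl⟩, hc i _ ?_⟩
    exact (Exists.choose_spec (⟨i, rfl⟩ : c i ∈ Set.range c)).symm
  have hθ2 : ∀ k, ∃ i, θ k = fam Xf δ Z i := fun k => ⟨_, rfl⟩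
  have hcard : (hZf.toFinset.card : ℝ) ≤ M * Xf.card := by
    obtain ⟨E, hE, hZE⟩ := hZX
    have : hZf.toFinset ⊆ E + Xf := by
      rw [← Finset.coe_subset, Finset.coe_add, cX, hZf.coe_toFinset]; exact hZE
    have := (Finset.card_le_card this).trans (Finset.card_add_le.trans (Nat.mul_le_mul_right _ hE))
    exact_mod_cast this
  have hb : ∀ y, (∀ γ ∈ Gs Xf δ, ‖ev γ y - 1‖ ≤ 1 / 2) → y ∈ Z := by
    intro y hy
    have := bogo (X := Xf) (Z := hZf.toFinset) ((mX 0).2 h0) (fun x hx => (mX _).2 (hneg x ((mX x).1 hx))) 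
      (by
        intro x hx a ha b hb c hc d hd a' ha' b' hb' c' hc' d' hd'
        simp only [mX] at *
        rw [Set.Finite.mem_toFinset]
        exact Set.add_mem_add (Set.add_mem_add (Set.add_mem_add (Set.add_mem_add ha hb) hc) hd) 
          (Set.mul_mem_mul hx (Set.add_mem_add (Set.add_mem_add (Set.add_mem_add ha' hb') hc') hd')))
      hM1 hcard hy
    exact hZf.mem_toFinset.1 this
  have D : Dat (JJ Q θ) (Psi θ) (1 / 4) (1 / 20) := JJ_dat hθ1 hθ2 hb (hZQ hZ0) hQn 
    (fun x hx y hy => Or.inl ⟨x, hx, y, hy, rfl⟩) (fun x hx y hy => Or.inr ⟨x, hx, y, hy, rfl⟩)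
  have hJZ : JJ Q θ ⊆ Z := JJ_sub hθ1 hb
  have hcov := hN R κ hκ θ X Q (by
    intro x hx y hy
    refine hZQ (h4Z (sS_mono h0 (show 2 ≤ 4 by norm_num) ?_))
    rw [sS_two, sub_eq_add_neg]
    exact Set.add_mem_add hx (hneg y hy))
  set J2 : Set R := {y | y ∈ JJ Q θ ∧ ‖Psi θ y‖ ≤ e2} with hJ2
  obtain ⟨hI1, hI2, hI3⟩ := D.main (hZf.subset hJZ) (d := d) (L := 20) (e2 := e2) (by simpa using hκ) e2pos 
    (by norm_num) (by push_cast; linarith) (by rw [e2d]; norm_num) hJ2 (I := {y | y ∈ JJ Q θ ∧ Psi θ y = 0}) rfl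
  set T : NonUnitalSubring R := NonUnitalSubring.closure J2 with hT
  set Y : Set R := Z ∩ T with hY
  have hJY : J2 ⊆ Y := fun y hy => ⟨hJZ hy.1, NonUnitalSubring.subset_closure hy⟩
  have hYT : NonUnitalSubring.closure Y = T := by
    apply le_antisymm
    · exact NonUnitalSubring.closure_le.2 Set.inter_subset_right
    · exact NonUnitalSubring.closure_mono hJY
  have hTs : ((T.toAddSubgroup : AddSubgroup R) : Set R) = T := rfl
  refine ⟨Y, Set.inter_subset_left, hZf.subset Set.inter_subset_left, ⟨⟨⟨hZ0, T.zero_mem⟩, ?_⟩, ?_⟩, ⟨?_, ?_⟩, 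
    {y | y ∈ JJ Q θ ∧ Psi θ y = 0}, ?_⟩
  · ext y
    refine ⟨fun h => ⟨hZneg y h.1, T.neg_mem h.2⟩, fun h => ?_⟩
    have h1 := hZneg _ h.1
    have h2 := T.neg_mem h.2
    rw [neg_neg] at h1 h2
    exact ⟨h1, h2⟩
  · have a1 := cov_inter hneg h4Z T.toAddSubgroup c2Z
    have a2 := cov_inter hneg h4Z T.toAddSubgroup cZZ
    rw [hTs] at a1 a2
    refine (a2.union a1).mono le_rfl ?_ subset_rfl
    refine Set.union_subset_union ?_ ?_
    · rintro _ ⟨a, ha, b, hb, rfl⟩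
      exact ⟨Set.mul_mem_mul ha.1 hb.1, T.mul_mem ha.2 hb.2⟩
    · rintro _ ⟨a, ha, b, hb, rfl⟩
      exact ⟨Set.add_mem_add ha.1 hb.1, T.add_mem ha.2 hb.2⟩
  · exact hZX.mono (le_max_left _ _) Set.inter_subset_left subset_rfl
  · exact hcov.mono (le_max_right _ _) subset_rfl hJY
  · rw [hYT]
    exact ⟨hI1, hI2.trans hJY, hI3⟩
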